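/- arXiv:1003.1156 — 2 statements merged into one kernel-verified Lean document; each statement's English description precedes it below -/
import Mathlib

section
/- Fix q_0 ∈ ℝ^n and a compact set P ⊆ ℝ^n. For v_0 ∈ ℝ^n let γ_{v_0} denote the maximal solution of the equation of motion with γ_{v_0}(0) = q_0 and γ̇_{v_0}(0) = v_0. Then there exist t_0 > 0 and c > 0 such that for all v_0 ∈ P and all 0 < t ≤ t_0: γ_{v_0} is defined on [0,t] and |∂γ_{v_0}^i(t)/∂v_0^j − t δ^i_j| ≤ c t² for all indices i, j. -/
open MeasureTheory Set
open scoped BigOperators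

noncomputable section

/-- Partial derivative of `f : ℝⁿ → ℝ` in the `j`-th coordinate direction. -/
def pd {n : ℕ} (f : (Fin n → ℝ) → ℝ) (j : Fin n) (q : Fin n → ℝ) : ℝ :=
  fderiv ℝ f q (Pi.single j 1)

/-- The classical equation of motion on the time interval `[0, t]`. -/
def IsClassical {n : ℕ} (B : Fin n → (Fin n → ℝ) → ℝ) (C : (Fin n → ℝ) → ℝ)
    (t : ℝ) (γ : ℝ → Fin n → ℝ) : Prop :=
  ∀ τ ∈ Icc (0:ℝ) t, ∀ i,
    deriv (deriv γ) τ i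
      + (∑ j, (pd (B i) j (γ τ) - pd (B j) i (γ τ)) * deriv γ τ j)
      + pd C i (γ τ) = 0

/-- The Jacobi operator `D_γ` (linearization of the equation of motion along `γ`). -/
def Jacobi {n : ℕ} (B : Fin n → (Fin n → ℝ) → ℝ) (C : (Fin n → ℝ) → ℝ)
    (γ ξ : ℝ → Fin n → ℝ) (τ : ℝ) (i : Fin n) : ℝ :=
  deriv (deriv ξ) τ i
    + (∑ j, (pd (B i) j (γ τ) - pd (B j) i (γ τ)) * deriv ξ τ j)
    + ∑ j, ((∑ k, pd (fun q => pd (B i) k q - pd (B k) i q) j (γ τ) * deriv γ τ k)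
        + pd (pd C i) j (γ τ)) * ξ τ j

/-- A classical path of duration `t` is nondegenerate if the only smooth based loop
annihilated by the Jacobi operator vanishes identically on `[0,t]`. -/
def Nondegenerate {n : ℕ} (B : Fin n → (Fin n → ℝ) → ℝ) (C : (Fin n → ℝ) → ℝ)
    (t : ℝ) (γ : ℝ → Fin n → ℝ) : Prop :=
  ∀ ξ : ℝ → Fin n → ℝ, ContDiff ℝ (⊤ : ℕ∞) ξ → ξ 0 = 0 → ξ t = 0 →
    (∀ τ ∈ Icc (0:ℝ) t, ∀ i, Jacobi B C γ ξ τ i = 0) →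
    ∀ τ ∈ Icc (0:ℝ) t, ξ τ = 0

/-- The action of a path of duration `t`. -/
def action {n : ℕ} (B : Fin n → (Fin n → ℝ) → ℝ) (C : (Fin n → ℝ) → ℝ)
    (t : ℝ) (γ : ℝ → Fin n → ℝ) : ℝ :=
  ∫ τ in (0:ℝ)..t,
    ((1:ℝ)/2 * ∑ i, deriv γ τ i ^ 2 + ∑ i, B i (γ τ) * deriv γ τ i - C (γ τ))

/-- A smooth family of nondegenerate classical paths with boundary values
`(t, q₀, q₁)` ranging over an open set `O ⊆ ℝ_{>0} × ℝⁿ × ℝⁿ`. -/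
structure SmoothFamily {n : ℕ} (B : Fin n → (Fin n → ℝ) → ℝ) (C : (Fin n → ℝ) → ℝ)
    (O : Set (ℝ × (Fin n → ℝ) × (Fin n → ℝ))) where
  f : ℝ → ℝ → (Fin n → ℝ) → (Fin n → ℝ) → Fin n → ℝ
  isOpen : IsOpen O
  pos : ∀ p ∈ O, 0 < p.1
  smooth : ContDiffOn ℝ (⊤ : ℕ∞)
      (fun p : ℝ × ℝ × (Fin n → ℝ) × (Fin n → ℝ) => f p.1 p.2.1 p.2.2.1 p.2.2.2)
      {p : ℝ × ℝ × (Fin n → ℝ) × (Fin n → ℝ) | p.2 ∈ O ∧ p.1 ∈ Icc 0 p.2.1}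
  pathSmooth : ∀ p ∈ O, ContDiff ℝ (⊤ : ℕ∞) fun τ => f τ p.1 p.2.1 p.2.2
  isClassical : ∀ p ∈ O, IsClassical B C p.1 fun τ => f τ p.1 p.2.1 p.2.2
  nondeg : ∀ p ∈ O, Nondegenerate B C p.1 fun τ => f τ p.1 p.2.1 p.2.2
  bdry0 : ∀ p ∈ O, f 0 p.1 p.2.1 p.2.2 = p.2.1
  bdry1 : ∀ p ∈ O, f p.1 p.1 p.2.1 p.2.2 = p.2.2

/-- The Hamilton function of a smooth family of classical paths. -/
def famS {n : ℕ} {B : Fin n → (Fin n → ℝ) → ℝ} {C : (Fin n → ℝ) → ℝ}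
    {O : Set (ℝ × (Fin n → ℝ) × (Fin n → ℝ))} (F : SmoothFamily B C O)
    (t : ℝ) (q0 q1 : Fin n → ℝ) : ℝ :=
  action B C t fun τ => F.f τ t q0 q1

/-- The mixed Hessian `(l, m) ↦ ∂²S/∂q₀^l∂q₁^m`. -/
def Hess01 {n : ℕ} (S : ℝ → (Fin n → ℝ) → (Fin n → ℝ) → ℝ)
    (t : ℝ) (q0 q1 : Fin n → ℝ) : Matrix (Fin n) (Fin n) ℝ :=
  Matrix.of fun l m =>
    fderiv ℝ (fun q0' => fderiv ℝ (fun q1' => S t q0' q1') q1 (Pi.single m 1)) q0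
      (Pi.single l 1)

/-- Heaviside's step function, with `Θ 0 = 1/2`. -/
def Heav (x : ℝ) : ℝ := if x < 0 then 0 else if x = 0 then 1/2 else 1

/-- The Green's kernel `G_γ` of a smooth family of nondegenerate classical paths. -/
def Green {n : ℕ} {B : Fin n → (Fin n → ℝ) → ℝ} {C : (Fin n → ℝ) → ℝ}
    {O : Set (ℝ × (Fin n → ℝ) × (Fin n → ℝ))} (F : SmoothFamily B C O)
    (t : ℝ) (q0 q1 : Fin n → ℝ) (ς τ : ℝ) (i j : Fin n) : ℝ :=
  Heav (ς - τ) * ∑ k, ∑ l,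
      fderiv ℝ (fun q => F.f ς t q q1 i) q0 (Pi.single k 1)
        * ((Hess01 (fun a b c => -(famS F a b c)) t q0 q1).transpose)⁻¹ k l
        * fderiv ℝ (fun q => F.f τ t q0 q j) q1 (Pi.single l 1)
  + Heav (τ - ς) * ∑ k, ∑ l,
      fderiv ℝ (fun q => F.f ς t q0 q i) q1 (Pi.single k 1)
        * (Hess01 (fun a b c => -(famS F a b c)) t q0 q1)⁻¹ k l
        * fderiv ℝ (fun q => F.f τ t q q1 j) q0 (Pi.single l 1)

/-- The Hessian of the action at a path `γ` of duration `t`, as a bilinear form. -/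
def hess {n : ℕ} (B : Fin n → (Fin n → ℝ) → ℝ) (C : (Fin n → ℝ) → ℝ)
    (t : ℝ) (γ ξ ζ : ℝ → Fin n → ℝ) : ℝ :=
  ∫ τ in (0:ℝ)..t,
    ((∑ i, deriv ξ τ i * deriv ζ τ i)
      + (∑ i, ∑ j, pd (B i) j (γ τ) * (deriv ξ τ i * ζ τ j + deriv ζ τ i * ξ τ j))
      + ∑ j, ∑ k,
          ((∑ i, pd (pd (B i) j) k (γ τ) * deriv γ τ i) - pd (pd C j) k (γ τ))
            * (ξ τ j * ζ τ k))

/-- The Jacobi fields `∂γ/∂q_a^j` of a smooth family (`a = 0` or `a = 1`). -/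
def jfield {n : ℕ} {B : Fin n → (Fin n → ℝ) → ℝ} {C : (Fin n → ℝ) → ℝ}
    {O : Set (ℝ × (Fin n → ℝ) × (Fin n → ℝ))} (F : SmoothFamily B C O)
    (t : ℝ) (q0 q1 : Fin n → ℝ) (a : Fin 2) (j : Fin n) : ℝ → Fin n → ℝ :=
  fun τ i =>
    if a = 0 then fderiv ℝ (fun q => F.f τ t q q1 i) q0 (Pi.single j 1)
    else fderiv ℝ (fun q => F.f τ t q0 q i) q1 (Pi.single j 1)

/-- Partial derivative of a function of `(t, q₀, q₁)` in the direction `q_a^j`. -/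
def pdS {n : ℕ} (S : ℝ → (Fin n → ℝ) → (Fin n → ℝ) → ℝ) (a : Fin 2) (j : Fin n)
    (t : ℝ) (q0 q1 : Fin n → ℝ) : ℝ :=
  if a = 0 then fderiv ℝ (fun q => S t q q1) q0 (Pi.single j 1)
  else fderiv ℝ (fun q => S t q0 q) q1 (Pi.single j 1)


open scoped ContDiff Topology NNReal

section Nemytskii
variable {K : Type} [TopologicalSpace K] [CompactSpace K]

/-- The operator `w ↦ (u ↦ (τ ↦ w τ (u τ)))`. -/
def ptApply (K : Type) [TopologicalSpace K] [CompactSpace K] (E G : Type)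
    [NormedAddCommGroup E] [NormedSpace ℝ E]
    [NormedAddCommGroup G] [NormedSpace ℝ G] :
    C(K, E →L[ℝ] G) →L[ℝ] C(K, E) →L[ℝ] C(K, G) :=
  LinearMap.mkContinuous₂
    (LinearMap.mk₂ ℝ (fun (w : C(K, E →L[ℝ] G)) (u : C(K, E)) =>
        (⟨fun τ => w τ (u τ), w.continuous.clm_apply u.continuous⟩ : C(K, G)))
      (fun w w' u => by ext τ; simp)
      (fun c w u => by ext τ; simp)
      (fun w u u' => by ext τ; simp)
      (fun c w u => by ext τ; simp)) 1
    (fun w u => by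
      rw [ContinuousMap.norm_le _ (by positivity)]
      intro τ
      simp only [LinearMap.mk₂_apply, ContinuousMap.coe_mk, one_mul]
      exact ((w τ).le_opNorm _).trans (mul_le_mul (w.norm_coe_le_norm τ) (u.norm_coe_le_norm τ)
        (norm_nonneg _) (by positivity)))

lemma ptApply_apply {E G : Type} [NormedAddCommGroup E] [NormedSpace ℝ E]
    [NormedAddCommGroup G] [NormedSpace ℝ G] (w : C(K, E →L[ℝ] G)) (u : C(K, E)) (τ : K) :
    ptApply K E G w u τ = w τ (u τ) := rfl

lemma nem_hasFDerivAt {E G : Type} [NormedAddCommGroup E] [NormedSpace ℝ E]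
    [NormedAddCommGroup G] [NormedSpace ℝ G] (F : C(E, G)) (F' : C(E, E →L[ℝ] G))
    (hF : ∀ x, HasFDerivAt F (F' x) x) (u : C(K, E)) :
    HasFDerivAt (fun u : C(K, E) => F.comp u) (ptApply K E G (F'.comp u)) u := by
  rw [hasFDerivAt_iff_isLittleO_nhds_zero, Asymptotics.isLittleO_iff]
  intro ε hε
  have hc : Continuous (fun u : C(K, E) => F'.comp u) := F'.continuous_postcomp
  obtain ⟨δ, hδ, h⟩ := (Metric.continuous_iff (f := fun u : C(K, E) => F'.comp u)).1 hc u ε hε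
  filter_upwards [Metric.ball_mem_nhds (0 : C(K, E)) hδ] with w hw
  rw [mem_ball_zero_iff] at hw
  rw [ContinuousMap.norm_le _ (by positivity)]
  intro τ
  have hwτ : ‖w τ‖ < δ := (w.norm_coe_le_norm τ).trans_lt hw
  have key := (convex_ball (u τ) δ).norm_image_sub_le_of_norm_hasFDerivWithin_le' (𝕜 := ℝ)
    (f := F) (f' := fun x => F' x) (φ := F' (u τ)) (C := ε) (x := u τ) (y := u τ + w τ)
    (fun x _ => (hF x).hasFDerivWithinAt) ?_ (Metric.mem_ball_self hδ) (by simpa using hwτ)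
  · simp only [ContinuousMap.sub_apply, ContinuousMap.comp_apply, ContinuousMap.add_apply,
      ptApply_apply]
    simp only [add_sub_cancel_left] at key
    exact key.trans (by gcongr; exact w.norm_coe_le_norm τ)
  · intro y hy
    have h1 := h (u + ContinuousMap.const K (y - u τ)) (by
      rw [dist_eq_norm, add_sub_cancel_left]
      refine (ContinuousMap.norm_lt_iff _ hδ).2 fun x => ?_
      simpa [dist_eq_norm] using hy)
    have h2 := (ContinuousMap.dist_apply_le_dist τ).trans h1.le
    rw [dist_eq_norm] at h2
    simpa using h2

lemma nem_contDiff_nat (n : ℕ) : ∀ {E G : Type} [NormedAddCommGroup E] [NormedSpace ℝ E]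
    [NormedAddCommGroup G] [NormedSpace ℝ G] (F : C(E, G)), ContDiff ℝ ∞ F →
    ContDiff ℝ n (fun u : C(K, E) => F.comp u) := by
  induction n with
  | zero =>
    intro E G _ _ _ _ F hF
    exact contDiff_zero.2 F.continuous_postcomp
  | succ n ih =>
    intro E G _ _ _ _ F hF
    have hd := contDiff_infty_iff_fderiv.1 hF
    let F' : C(E, E →L[ℝ] G) := ⟨fderiv ℝ F, hd.2.continuous⟩
    push_cast
    refine contDiff_succ_iff_hasFDerivAt.2 ⟨fun u => ptApply K E G (F'.comp u), ?_, fun u =>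
      nem_hasFDerivAt F F' (fun x => (hd.1 x).hasFDerivAt) u⟩
    exact (ptApply K E G).contDiff.comp (ih F' hd.2)

lemma nem_contDiff {E G : Type} [NormedAddCommGroup E] [NormedSpace ℝ E]
    [NormedAddCommGroup G] [NormedSpace ℝ G] (F : C(E, G)) (hF : ContDiff ℝ ∞ F) :
    ContDiff ℝ ∞ (fun u : C(K, E) => F.comp u) :=
  contDiff_infty.2 fun n => nem_contDiff_nat n F hF

end Nemytskii

/-- smooth dependence of fixed points of contractions -/
lemma fixedPoint_contDiffAt {X Y : Type} [NormedAddCommGroup X] [NormedSpace ℝ X]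
    [CompleteSpace X] [NormedAddCommGroup Y] [NormedSpace ℝ Y] [CompleteSpace Y]
    (T : Y × X → X) (hT : ContDiff ℝ ∞ T) (S : Set Y) (hS : IsOpen S)
    (hL : ∀ y ∈ S, LipschitzWith (1/2) (fun x => T (y, x)))
    (φ : Y → X) (hφ : ∀ y ∈ S, T (y, φ y) = φ y) (y0 : Y) (hy : y0 ∈ S) :
    ContDiffAt ℝ ∞ φ y0 := by
  let Φ : Y × X → X := fun p => p.2 - T p
  have hΦ : ContDiffAt ℝ ∞ Φ (y0, φ y0) := (contDiff_snd.sub hT).contDiffAt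
  have hTd : HasFDerivAt T (fderiv ℝ T (y0, φ y0)) (y0, φ y0) :=
    (hT.differentiable (by simp) _).hasFDerivAt
  have hd : fderiv ℝ Φ (y0, φ y0) = ContinuousLinearMap.snd ℝ Y X - fderiv ℝ T (y0, φ y0) :=
    (hasFDerivAt_snd.sub hTd).fderiv
  have hn : ‖fderiv ℝ T (y0, φ y0) ∘L .inr ℝ Y X‖ < 1 := by
    have h1 : HasFDerivAt (fun x => T (y0, x)) (fderiv ℝ T (y0, φ y0) ∘L .inr ℝ Y X) (φ y0) :=
      HasFDerivAt.comp (φ y0) hTd (hasFDerivAt_prodMk_right y0 (φ y0))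
    have := h1.le_of_lipschitz (hL y0 hy)
    refine this.trans_lt ?_
    norm_num
  have hinv : (fderiv ℝ Φ (y0, φ y0) ∘L .inr ℝ Y X).IsInvertible := by
    have : fderiv ℝ Φ (y0, φ y0) ∘L .inr ℝ Y X
        = ((Units.oneSub _ hn : (X →L[ℝ] X)ˣ) : X →L[ℝ] X) := by
      rw [hd, Units.val_oneSub]
      ext x
      simp
    rw [this]
    exact ⟨ContinuousLinearEquiv.ofUnit (Units.oneSub _ hn), by ext x; rfl⟩
  have hc := hΦ.contDiffAt_implicitFunction (by simp) hinv
  have he := hΦ.eventually_apply_implicitFunction (by simp) hinv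
  refine hc.congr_of_eventuallyEq ?_
  filter_upwards [he, hS.mem_nhds hy] with y h1 h2
  have h3 : T (y, hΦ.implicitFunction (by simp) hinv y) = hΦ.implicitFunction (by simp) hinv y := by
    have : Φ (y0, φ y0) = 0 := sub_eq_zero.2 (hφ y0 hy).symm
    rw [this] at h1
    exact (sub_eq_zero.1 h1).symm
  have h4 := (hL y h2).dist_le_mul (φ y) (hΦ.implicitFunction (by simp) hinv y)
  simp only [h3, hφ y h2] at h4
  have h5 : dist (φ y) (hΦ.implicitFunction (by simp) hinv y) ≤ 0 := by
    norm_num at h4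
    linarith
  exact dist_le_zero.1 h5

section Flow
set_option linter.unusedSectionVars false

/-- the unit interval -/
abbrev UI : Type := Icc (0:ℝ) 1

/-- projection to the unit interval -/
abbrev prj (r : ℝ) : UI := projIcc (0:ℝ) 1 zero_le_one r

lemma prj_cont : Continuous prj := continuous_projIcc

lemma prj_of {r : ℝ} (h0 : 0 ≤ r) (h1 : r ≤ 1) : prj r = ⟨r, h0, h1⟩ :=
  projIcc_of_mem zero_le_one ⟨h0, h1⟩

variable {E : Type} [NormedAddCommGroup E] [NormedSpace ℝ E] [CompleteSpace E]

lemma ext_cont (w : C(UI, E)) : Continuous (fun r => w (prj r)) :=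
  w.continuous.comp prj_cont

/-- the primitive of a continuous function on the unit interval -/
def primitiveFun (w : C(UI, E)) : C(UI, E) :=
  ⟨fun τ => ∫ r in (0:ℝ)..τ, w (prj r),
    (intervalIntegral.continuous_primitive
      (fun a b => (ext_cont w).intervalIntegrable a b) 0).comp continuous_subtype_val⟩

lemma primitiveFun_apply (w : C(UI, E)) (τ : UI) :
    primitiveFun w τ = ∫ r in (0:ℝ)..τ, w (prj r) := rfl

lemma primitiveFun_norm (w : C(UI, E)) : ‖primitiveFun w‖ ≤ 1 * ‖w‖ := by
  rw [ContinuousMap.norm_le _ (by positivity)]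
  intro τ
  rw [primitiveFun_apply]
  refine (intervalIntegral.norm_integral_le_of_norm_le_const
    (C := ‖w‖) fun r _ => w.norm_coe_le_norm _).trans ?_
  rw [sub_zero, abs_of_nonneg τ.2.1, one_mul]
  exact mul_le_of_le_one_right (norm_nonneg _) τ.2.2

/-- the primitive as a continuous linear operator -/
def primitive (E : Type) [NormedAddCommGroup E] [NormedSpace ℝ E] [CompleteSpace E] :
    C(UI, E) →L[ℝ] C(UI, E) :=
  LinearMap.mkContinuous
    { toFun := primitiveFun
      map_add' := fun w w' => by
        ext τ
        simp only [primitiveFun_apply, ContinuousMap.add_apply]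
        exact intervalIntegral.integral_add ((ext_cont w).intervalIntegrable _ _)
          ((ext_cont w').intervalIntegrable _ _)
      map_smul' := fun c w => by
        ext τ
        simp only [primitiveFun_apply, ContinuousMap.smul_apply, RingHom.id_apply]
        exact intervalIntegral.integral_smul c _ } 1 primitiveFun_norm

lemma primitive_apply (w : C(UI, E)) (τ : UI) :
    primitive E w τ = ∫ r in (0:ℝ)..τ, w (prj r) := rfl

lemma primitive_norm (w : C(UI, E)) : ‖primitive E w‖ ≤ ‖w‖ := by
  have h := primitiveFun_norm w
  rw [one_mul] at h
  exact h

/-- the (rescaled) Picard operator -/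
def picard (F : C(E, E)) (p : (E × ℝ) × C(UI, E)) : C(UI, E) :=
  ContinuousLinearMap.const ℝ UI p.1.1 + p.1.2 • primitive E (F.comp p.2)

lemma picard_apply (F : C(E, E)) (x : E) (s : ℝ) (u : C(UI, E)) (τ : UI) :
    picard F ((x, s), u) τ = x + s • ∫ r in (0:ℝ)..τ, F (u (prj r)) := rfl

lemma picard_contDiff (F : C(E, E)) (hF : ContDiff ℝ ∞ F) : ContDiff ℝ ∞ (picard F) := by
  have h1 : ContDiff ℝ ∞ (fun p : (E × ℝ) × C(UI, E) => F.comp p.2) :=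
    (nem_contDiff (K := UI) F hF).comp contDiff_snd
  have h2 := (primitive E).contDiff.comp h1
  have h3 : ContDiff ℝ ∞ (fun p : (E × ℝ) × C(UI, E) => p.1.2) := by fun_prop
  have h4 : ContDiff ℝ ∞ (fun p : (E × ℝ) × C(UI, E) => ContinuousLinearMap.const ℝ UI p.1.1) :=
    
    (ContinuousLinearMap.const ℝ UI : E →L[ℝ] C(UI, E)).contDiff.comp
      (contDiff_fst.comp contDiff_fst)
  exact h4.add (h3.smul h2)

lemma comp_dist_le (F : C(E, E)) (K : ℝ≥0) (hK : LipschitzWith K F) (u w : C(UI, E)) :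
    ‖F.comp u - F.comp w‖ ≤ K * ‖u - w‖ := by
  rw [ContinuousMap.norm_le _ (by positivity)]
  intro τ
  exact (hK.norm_sub_le _ _).trans (by gcongr; exact (u - w).norm_coe_le_norm τ)

lemma picard_sub_le (F : C(E, E)) (K : ℝ≥0) (hK : LipschitzWith K F) (x y : E) (s : ℝ)
    (hs : |s| * K ≤ 1 / 2) (u w : C(UI, E)) :
    ‖picard F ((x, s), u) - picard F ((y, s), w)‖ ≤ ‖x - y‖ + 1 / 2 * ‖u - w‖ := by
  have h : picard F ((x, s), u) - picard F ((y, s), w)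
      = ContinuousLinearMap.const ℝ UI (x - y) + s • primitive E (F.comp u - F.comp w) := by
    simp only [picard, map_sub, smul_sub]
    abel
  rw [h]
  refine (norm_add_le _ _).trans (add_le_add ?_ ?_)
  · rw [ContinuousMap.norm_le _ (by positivity)]
    intro τ
    simp
  · rw [norm_smul, Real.norm_eq_abs]
    calc |s| * ‖primitive E (F.comp u - F.comp w)‖ ≤ |s| * (K * ‖u - w‖) := by
          gcongr
          exact (primitive_norm _).trans (comp_dist_le F K hK u w)
      _ = (|s| * K) * ‖u - w‖ := by ring
      _ ≤ _ := by gcongr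

lemma picard_lip (F : C(E, E)) (K : ℝ≥0) (hK : LipschitzWith K F) (x : E) (s : ℝ)
    (hs : |s| * K ≤ 1 / 2) : LipschitzWith (1 / 2) (fun u => picard F ((x, s), u)) := by
  refine LipschitzWith.of_dist_le_mul fun u w => ?_
  have := picard_sub_le F K hK x x s hs u w
  rw [dist_eq_norm, dist_eq_norm]
  simpa using this

theorem flow_exists (F : C(E, E)) (hF : ContDiff ℝ ∞ F) (K : ℝ≥0) (hK : LipschitzWith K F) :
    ∃ T : ℝ, 0 < T ∧ ∃ x : E → ℝ → E,
      ContDiffOn ℝ ∞ (fun p : E × ℝ => x p.1 p.2) (univ ×ˢ Ioo (-T) T) ∧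
      (∀ a, x a 0 = a) ∧
      (∀ a, ∀ t ∈ Ioo (-T) T, HasDerivAt (x a) (F (x a t)) t) ∧
      ∀ a b, ∀ t ∈ Ioo (-T) T, ‖x a t - x b t‖ ≤ 2 * ‖a - b‖ := by
  set T : ℝ := 1 / (2 * (K + 1)) with hTdef
  have hT : 0 < T := by positivity
  have hTs : ∀ s ∈ Ioo (-T) T, |s| * K ≤ 1 / 2 := by
    intro s hs
    have h1 : |s| ≤ T := (abs_lt.2 hs).le
    calc |s| * K ≤ T * (K + 1) := by gcongr; linarith
      _ = 1 / 2 := by rw [hTdef]; field_simp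
  have hex : ∀ p : E × ℝ, ∃ u : C(UI, E), p.2 ∈ Ioo (-T) T → picard F (p, u) = u := by
    intro p
    by_cases h : p.2 ∈ Ioo (-T) T
    · have hc : ContractingWith (1 / 2) (fun u => picard F (p, u)) :=
        ⟨by norm_num, picard_lip F K hK p.1 p.2 (hTs _ h)⟩
      exact ⟨_, fun _ => hc.fixedPoint_isFixedPt⟩
    · exact ⟨0, fun h' => absurd h' h⟩
  choose u hu using hex
  have huniq : ∀ a, ∀ s ∈ Ioo (-T) T, ∀ w, picard F ((a, s), w) = w → w = u (a, s) := by
    intro a s hs w hw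
    have hc : ContractingWith (1 / 2) (fun u => picard F ((a, s), u)) :=
      ⟨by norm_num, picard_lip F K hK a s (hTs _ hs)⟩
    exact hc.fixedPoint_unique' hw (hu (a, s) hs)
  have hsc : ∀ s ∈ Ioo (-T) T, ∀ τ : UI, s * τ ∈ Ioo (-T) T := by
    intro s hs τ
    rw [mem_Ioo, ← abs_lt] at hs ⊢
    rw [abs_mul, abs_of_nonneg τ.2.1]
    exact (mul_le_of_le_one_right (abs_nonneg _) τ.2.2).trans_lt hs
  have hcd : ∀ p : E × ℝ, p.2 ∈ Ioo (-T) T → ContDiffAt ℝ ∞ u p := by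
    intro p hp
    refine fixedPoint_contDiffAt (picard F) (picard_contDiff F hF) (univ ×ˢ Ioo (-T) T)
      (isOpen_univ.prod isOpen_Ioo) ?_ u ?_ p ⟨trivial, hp⟩
    · intro y hy
      exact picard_lip F K hK y.1 y.2 (hTs _ hy.2)
    · intro y hy
      exact hu y hy.2
  -- self-similarity
  have hself : ∀ a, ∀ s ∈ Ioo (-T) T, ∀ τ : UI, u (a, s * τ) 1 = u (a, s) τ := by
    intro a s hs τ
    let m : C(UI, UI) := ⟨fun σ => τ * σ, by fun_prop⟩
    have hw := huniq a (s * τ) (hsc s hs τ) ((u (a, s)).comp m) (by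
      ext σ
      rw [picard_apply]
      have h1 : (u (a, s)).comp m σ = picard F ((a, s), u (a, s)) (τ * σ) := by
        rw [hu (a, s) hs]; rfl
      rw [h1, picard_apply, mul_smul]
      congr 2
      have h2 := intervalIntegral.smul_integral_comp_mul_left (a := 0) (b := (σ : ℝ))
        (fun r => F (u (a, s) (prj r))) (τ : ℝ)
      rw [mul_zero] at h2
      rw [show ((τ * σ : UI) : ℝ) = (τ : ℝ) * σ from rfl, ← h2]
      congr 1
      refine intervalIntegral.integral_congr fun r hr => ?_
      rw [uIcc_of_le σ.2.1] at hr
      have hr1 : r ≤ 1 := hr.2.trans σ.2.2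
      simp only [ContinuousMap.comp_apply]
      congr 2
      rw [prj_of hr.1 hr1, prj_of (mul_nonneg τ.2.1 hr.1) (mul_le_one₀ τ.2.2 hr.1 hr1)]
      rfl)
    rw [← hw]
    simp [m]
  have hintegral : ∀ a, ∀ s ∈ Ioo (-T) T, u (a, s) 1 = a + ∫ r in (0:ℝ)..s, F (u (a, r) 1) := by
    intro a s hs
    conv_lhs => rw [← hu (a, s) hs]
    rw [picard_apply]
    congr 1
    have h2 := intervalIntegral.smul_integral_comp_mul_left (a := 0) (b := (1 : ℝ))
        (fun r => F (u (a, r) 1)) s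
    rw [mul_zero, mul_one] at h2
    rw [← h2]
    congr 1
    refine intervalIntegral.integral_congr fun r hr => ?_
    have hr' : r ∈ Icc (0:ℝ) 1 := by simpa using hr
    rw [prj_of hr'.1 hr'.2]
    rw [← hself a s hs ⟨r, hr'⟩]
  have hsm : ContDiffOn ℝ ∞ (fun p : E × ℝ => u (p.1, p.2) 1) (univ ×ˢ Ioo (-T) T) := by
    intro p hp
    have := (ContinuousMap.evalCLM ℝ (1 : UI) : C(UI, E) →L[ℝ] E).contDiff.contDiffAt.comp p
      (hcd p hp.2)
    exact this.contDiffWithinAt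
  refine ⟨T, hT, fun a t => u (a, t) 1, hsm, ?_, ?_, ?_⟩
  · intro a
    have h := hintegral a 0 ⟨by linarith, hT⟩
    simpa using h
  · intro a t ht
    have hcont : ContinuousOn (fun r => F (u (a, r) 1)) (Ioo (-T) T) := by
      refine F.continuous.comp_continuousOn ?_
      exact hsm.continuousOn.comp (f := fun r : ℝ => (a, r)) (by fun_prop) fun r hr => ⟨trivial, hr⟩
    have h0 : (0:ℝ) ∈ Ioo (-T) T := ⟨by linarith, hT⟩
    have hsub : uIcc 0 t ⊆ Ioo (-T) T := (convex_Ioo (-T) T).ordConnected.uIcc_subset h0 ht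
    have h1 := intervalIntegral.integral_hasDerivAt_right
      (hcont.mono hsub).intervalIntegrable
      (hcont.stronglyMeasurableAtFilter isOpen_Ioo t ht)
      (hcont.continuousAt (isOpen_Ioo.mem_nhds ht))
    refine (h1.const_add a).congr_of_eventuallyEq ?_
    filter_upwards [isOpen_Ioo.mem_nhds ht] with s hs
    exact hintegral a s hs
  · intro a b t ht
    have h1 := picard_sub_le F K hK a b t (hTs t ht) (u (a, t)) (u (b, t))
    rw [hu (a, t) ht, hu (b, t) ht] at h1
    have h2 := (u (a, t) - u (b, t)).norm_coe_le_norm 1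
    rw [ContinuousMap.sub_apply] at h2
    linarith

end Flow

/-- the acceleration prescribed by the equation of motion -/
def accel {n : ℕ} (B : Fin n → (Fin n → ℝ) → ℝ) (C : (Fin n → ℝ) → ℝ)
    (p : (Fin n → ℝ) × (Fin n → ℝ)) : Fin n → ℝ := fun i =>
  -((∑ j, (pd (B i) j p.1 - pd (B j) i p.1) * p.2 j) + pd C i p.1)

lemma pd_contDiff {n : ℕ} (f : (Fin n → ℝ) → ℝ) (hf : ContDiff ℝ ∞ f) (j : Fin n) :
    ContDiff ℝ ∞ (pd f j) :=
  (contDiff_infty_iff_fderiv.1 hf).2.clm_apply contDiff_const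

lemma accel_contDiff {n : ℕ} (B : Fin n → (Fin n → ℝ) → ℝ) (C : (Fin n → ℝ) → ℝ)
    (hB : ∀ i, ContDiff ℝ ∞ (B i)) (hC : ContDiff ℝ ∞ C) :
    ContDiff ℝ ∞ (accel B C) := by
  rw [contDiff_pi]
  intro i
  have h1 : ∀ f : (Fin n → ℝ) → ℝ, ContDiff ℝ ∞ f → ∀ j,
      ContDiff ℝ ∞ (fun p : (Fin n → ℝ) × (Fin n → ℝ) => pd f j p.1) :=
    fun f hf j => (pd_contDiff f hf j).comp contDiff_fst
  refine ((ContDiff.sum fun j _ => ((h1 _ (hB i) j).sub (h1 _ (hB j) i)).mul ?_).add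
    (h1 C hC i)).neg
  exact (contDiff_apply ℝ ℝ j).comp contDiff_snd

theorem statement18 {n : ℕ} (hn : 1 ≤ n)
    (B : Fin n → (Fin n → ℝ) → ℝ) (C : (Fin n → ℝ) → ℝ)
    (hB : ∀ i, ContDiff ℝ (⊤ : ℕ∞) (B i)) (hC : ContDiff ℝ (⊤ : ℕ∞) C)
    (q0 : Fin n → ℝ) (P : Set (Fin n → ℝ)) (hP : IsCompact P) :
    ∃ t0 : ℝ, 0 < t0 ∧ ∃ c : ℝ, 0 < c ∧
      ∃ U : Set (Fin n → ℝ), IsOpen U ∧ P ⊆ U ∧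
        ∃ γ : (Fin n → ℝ) → ℝ → Fin n → ℝ,
          ContDiffOn ℝ (⊤ : ℕ∞) (fun p : (Fin n → ℝ) × ℝ => γ p.1 p.2)
            (U ×ˢ Ioo (-t0) (2 * t0)) ∧
          (∀ v ∈ U, IsClassical B C t0 (γ v) ∧ γ v 0 = q0 ∧ deriv (γ v) 0 = v) ∧
          ∀ v0 ∈ P, ∀ t : ℝ, 0 < t → t ≤ t0 → ∀ i j : Fin n,
            |fderiv ℝ (fun v => γ v t i) v0 (Pi.single j 1)
                - t * (if i = j then 1 else 0)| ≤ c * t ^ 2 := by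
  obtain ⟨ρ, hρ, hPρ⟩ := hP.isBounded.subset_ball_lt 0 0
  let χ : ContDiffBump ((q0, 0) : (Fin n → ℝ) × (Fin n → ℝ)) :=
    ⟨ρ + 1, ρ + 2, by linarith, by linarith⟩
  let F0 : (Fin n → ℝ) × (Fin n → ℝ) → (Fin n → ℝ) × (Fin n → ℝ) := fun p => (p.2, accel B C p)
  have hF0 : ContDiff ℝ ∞ F0 := contDiff_snd.prodMk (accel_contDiff B C hB hC)
  have hFc : ContDiff ℝ ∞ (fun p => χ p • F0 p) := χ.contDiff.smul hF0
  have hsupp : HasCompactSupport (fun p => χ p • F0 p) := χ.hasCompactSupport.smul_right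
  let F : C((Fin n → ℝ) × (Fin n → ℝ), (Fin n → ℝ) × (Fin n → ℝ)) :=
    ⟨fun p => χ p • F0 p, hFc.continuous⟩
  obtain ⟨K, hK⟩ := hFc.lipschitzWith_of_hasCompactSupport hsupp (by simp)
  obtain ⟨M, hM⟩ := hsupp.exists_bound_of_continuous hFc.continuous
  have hM0 : 0 ≤ M := (norm_nonneg _).trans (hM 0)
  obtain ⟨T, hT, x, hxs, hx0, hxd, hxl⟩ := flow_exists F hFc K hK
  let t0 : ℝ := min (T / 3) (1 / (3 * (M + 1)))
  have ht0 : 0 < t0 := lt_min (by positivity) (by positivity)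
  have ht0T : 2 * t0 < T := by
    have : t0 ≤ T / 3 := min_le_left _ _
    linarith
  have ht0M : M * (2 * t0) < 1 := by
    have h1 : t0 ≤ 1 / (3 * (M + 1)) := min_le_right _ _
    have h2 : (M + 1) * t0 ≤ 1 / 3 := by
      calc (M + 1) * t0 ≤ (M + 1) * (1 / (3 * (M + 1))) := by gcongr
        _ = 1 / 3 := by field_simp
    nlinarith
  have hin : ∀ t ∈ Ioo (-(2 * t0)) (2 * t0), t ∈ Ioo (-T) T := fun t ht =>
    ⟨by linarith [ht.1], by linarith [ht.2]⟩
  -- the trajectories stay in the region where the cutoff is one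
  have hstay : ∀ v ∈ Metric.ball (0 : Fin n → ℝ) ρ, ∀ t ∈ Ioo (-(2 * t0)) (2 * t0),
      F (x (q0, v) t) = F0 (x (q0, v) t) := by
    intro v hv t ht
    have h1 : ‖x (q0, v) t - x (q0, v) 0‖ ≤ M * ‖t - 0‖ :=
      (convex_Ioo (-(2 * t0)) (2 * t0)).norm_image_sub_le_of_norm_hasDerivWithin_le
        (fun s hs => (hxd (q0, v) s (hin s hs)).hasDerivWithinAt) (fun s _ => hM _)
        ⟨by linarith, by linarith⟩ ht
    rw [hx0, sub_zero, Real.norm_eq_abs] at h1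
    have h2 : |t| ≤ 2 * t0 := (abs_lt.2 ht).le
    have h3 : M * |t| ≤ M * (2 * t0) := by gcongr
    have h4 : ‖((q0, v) : (Fin n → ℝ) × (Fin n → ℝ)) - (q0, 0)‖ < ρ := by
      simpa [Prod.norm_def, hρ] using hv
    have h5 : χ (x (q0, v) t) = 1 := by
      refine χ.one_of_mem_closedBall ?_
      rw [Metric.mem_closedBall, dist_eq_norm]
      change _ ≤ ρ + 1
      have h6 := norm_add_le (x (q0, v) t - (q0, v))
        (((q0, v) : (Fin n → ℝ) × (Fin n → ℝ)) - (q0, 0))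
      rw [sub_add_sub_cancel] at h6
      linarith
    change χ _ • F0 _ = _
    rw [h5, one_smul]
  have hd : ∀ v ∈ Metric.ball (0 : Fin n → ℝ) ρ, ∀ t ∈ Ioo (-(2 * t0)) (2 * t0),
      HasDerivAt (x (q0, v)) (F0 (x (q0, v) t)) t := by
    intro v hv t ht
    rw [← hstay v hv t ht]
    exact hxd _ t (hin t ht)
  have hd1 : ∀ v ∈ Metric.ball (0 : Fin n → ℝ) ρ, ∀ t ∈ Ioo (-(2 * t0)) (2 * t0),
      HasDerivAt (fun s => (x (q0, v) s).1) (x (q0, v) t).2 t :=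
    fun v hv t ht => (hd v hv t ht).fst
  have hd2 : ∀ v ∈ Metric.ball (0 : Fin n → ℝ) ρ, ∀ t ∈ Ioo (-(2 * t0)) (2 * t0),
      HasDerivAt (fun s => (x (q0, v) s).2) (accel B C (x (q0, v) t)) t :=
    fun v hv t ht => (hd v hv t ht).snd
  have hsm : ContDiffOn ℝ ∞ (fun p : (Fin n → ℝ) × ℝ => (x (q0, p.1) p.2).1)
      (Metric.ball (0 : Fin n → ℝ) ρ ×ˢ Ioo (-t0) (2 * t0)) := by
    have h1 : ContDiff ℝ ∞ (fun p : (Fin n → ℝ) × ℝ =>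
        (((q0, p.1), p.2) : ((Fin n → ℝ) × (Fin n → ℝ)) × ℝ)) := by fun_prop
    have h2 := hxs.comp h1.contDiffOn (s := Metric.ball (0 : Fin n → ℝ) ρ ×ˢ Ioo (-t0) (2 * t0))
      (fun p hp => ⟨trivial, hin _ ⟨by linarith [hp.2.1], hp.2.2⟩⟩)
    exact contDiff_fst.comp_contDiffOn h2
  -- Lipschitz estimate
  have hlip : ∀ v ∈ Metric.ball (0 : Fin n → ℝ) ρ, ∀ w ∈ Metric.ball (0 : Fin n → ℝ) ρ,
      ∀ t : ℝ, 0 < t → t ≤ t0 →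
      ‖((x (q0, v) t).1 - t • v) - ((x (q0, w) t).1 - t • w)‖ ≤ 2 * K * t ^ 2 * ‖v - w‖ := by
    intro v hv w hw t ht htt
    have hinn : ∀ s ∈ Icc (0:ℝ) t, s ∈ Ioo (-(2 * t0)) (2 * t0) := fun s hs =>
      ⟨by linarith [hs.1], by linarith [hs.2]⟩
    have hacc : ∀ s ∈ Icc (0:ℝ) t,
        ‖accel B C (x (q0, v) s) - accel B C (x (q0, w) s)‖ ≤ 2 * K * ‖v - w‖ := by
      intro s hs
      have h1 := hK.norm_sub_le (x (q0, v) s) (x (q0, w) s)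
      have h2 : (F (x (q0, v) s) - F (x (q0, w) s)).2
          = accel B C (x (q0, v) s) - accel B C (x (q0, w) s) := by
        rw [hstay v hv s (hinn s hs), hstay w hw s (hinn s hs)]
        rfl
      rw [← h2]
      refine (norm_snd_le _).trans (h1.trans ?_)
      have h3 := hxl (q0, v) (q0, w) s (hin s (hinn s hs))
      have h4 : ‖((q0, v) : (Fin n → ℝ) × (Fin n → ℝ)) - (q0, w)‖ = ‖v - w‖ := by
        simp [Prod.norm_def]
      rw [h4] at h3
      calc (K:ℝ) * ‖x (q0, v) s - x (q0, w) s‖ ≤ K * (2 * ‖v - w‖) := by gcongr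
        _ = _ := by ring
    have hvel : ∀ s ∈ Icc (0:ℝ) t,
        ‖((x (q0, v) s).2 - (x (q0, w) s).2) - (v - w)‖ ≤ 2 * K * ‖v - w‖ * t := by
      intro s hs
      have h1 := norm_image_sub_le_of_norm_deriv_le_segment'
        (f := fun s => (x (q0, v) s).2 - (x (q0, w) s).2) (a := 0) (b := t)
        (C := 2 * K * ‖v - w‖)
        (fun r hr => ((hd2 v hv r (hinn r hr)).sub (hd2 w hw r (hinn r hr))).hasDerivWithinAt)
        (fun r hr => hacc r ⟨hr.1, hr.2.le⟩) s hs
      simp only [hx0, sub_zero] at h1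
      exact h1.trans (by gcongr; exact hs.2)
    have h1 := norm_image_sub_le_of_norm_deriv_le_segment'
        (f := fun s => ((x (q0, v) s).1 - (x (q0, w) s).1) - s • (v - w)) (a := 0) (b := t)
        (C := 2 * K * ‖v - w‖ * t) (f' := fun s => ((x (q0, v) s).2 - (x (q0, w) s).2) - (v - w))
        (fun r hr => by
          have h2 := ((hasDerivAt_id r).smul_const (v - w))
          rw [one_smul] at h2
          exact (((hd1 v hv r (hinn r hr)).sub (hd1 w hw r (hinn r hr))).sub h2).hasDerivWithinAt)
        (fun r hr => hvel r ⟨hr.1, hr.2.le⟩) t ⟨ht.le, le_rfl⟩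
    simp only [hx0, sub_zero, zero_smul, sub_self] at h1
    have h3 : ((x (q0, v) t).1 - t • v) - ((x (q0, w) t).1 - t • w)
        = ((x (q0, v) t).1 - (x (q0, w) t).1) - t • (v - w) := by
      rw [smul_sub]; abel
    rw [h3]
    exact h1.trans (le_of_eq (by ring))
  refine ⟨t0, ht0, 2 * K + 1, by positivity, Metric.ball 0 ρ, Metric.isOpen_ball, hPρ,
    fun v t => (x (q0, v) t).1, hsm, ?_, ?_⟩
  · intro v hv
    have h00 : (0:ℝ) ∈ Ioo (-(2 * t0)) (2 * t0) := ⟨by linarith, by linarith⟩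
    refine ⟨?_, by simp [hx0], by rw [(hd1 v hv 0 h00).deriv, hx0]⟩
    intro τ hτ i
    have hτ' : τ ∈ Ioo (-(2 * t0)) (2 * t0) := ⟨by linarith [hτ.1], by linarith [hτ.2]⟩
    have he : deriv (fun s => (x (q0, v) s).1) =ᶠ[𝓝 τ] fun s => (x (q0, v) s).2 := by
      filter_upwards [isOpen_Ioo.mem_nhds hτ'] with s hs
      exact (hd1 v hv s hs).deriv
    rw [he.deriv_eq, (hd2 v hv τ hτ').deriv, (hd1 v hv τ hτ').deriv]
    simp only [accel]
    ring
  · intro v0 hv0 t ht htt i j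
    have hv := hPρ hv0
    have hdiff : DifferentiableAt ℝ (fun v => (x (q0, v) t).1) v0 := by
      have h1 : ContDiffAt ℝ ∞ (fun p : (Fin n → ℝ) × ℝ => (x (q0, p.1) p.2).1) (v0, t) :=
        hsm.contDiffAt ((Metric.isOpen_ball.prod isOpen_Ioo).mem_nhds
          ⟨hv, by linarith, by linarith⟩)
      have h2 : DifferentiableAt ℝ (fun v : Fin n → ℝ => (v, t)) v0 := by fun_prop
      exact DifferentiableAt.comp (g := fun p : (Fin n → ℝ) × ℝ => (x (q0, p.1) p.2).1)
        (f := fun v : Fin n → ℝ => (v, t)) v0 (h1.differentiableAt (by simp)) h2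
    have h3 : HasFDerivAt (fun v => (x (q0, v) t).1 - t • v)
        (fderiv ℝ (fun v => (x (q0, v) t).1) v0 - t • ContinuousLinearMap.id ℝ (Fin n → ℝ)) v0 :=
      hdiff.hasFDerivAt.sub ((hasFDerivAt_id v0).const_smul t)
    have h4 := h3.le_of_lip' (C := 2 * K * t ^ 2) (by positivity) (by
      filter_upwards [Metric.isOpen_ball.mem_nhds hv] with v hv'
      exact hlip v hv' v0 hv t ht htt)
    have h5 : fderiv ℝ (fun v => (x (q0, v) t).1 i) v0 (Pi.single j 1)
        = fderiv ℝ (fun v => (x (q0, v) t).1) v0 (Pi.single j 1) i := by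
      have := hasFDerivAt_pi'.1 hdiff.hasFDerivAt i
      rw [this.fderiv]
      rfl
    have h6 := (fderiv ℝ (fun v => (x (q0, v) t).1) v0
      - t • ContinuousLinearMap.id ℝ (Fin n → ℝ)).le_opNorm (Pi.single j 1)
    have h7 : ‖(Pi.single j 1 : Fin n → ℝ)‖ ≤ 1 := by
      refine (pi_norm_le_iff_of_nonneg zero_le_one).2 fun k => ?_
      rw [Pi.single_apply]
      split_ifs <;> simp
    have h8 := (norm_le_pi_norm _ i).trans
      (h6.trans ((mul_le_of_le_one_right (norm_nonneg _) h7).trans h4))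
    have h9 : (Pi.single j (1:ℝ) : Fin n → ℝ) i = if i = j then 1 else 0 := by
      rw [Pi.single_apply]
    simp only [sub_apply, smul_apply,
      ContinuousLinearMap.id_apply, Pi.sub_apply, Pi.smul_apply, smul_eq_mul, h9,
      Real.norm_eq_abs] at h8
    rw [h5]
    refine h8.trans ?_
    nlinarith [sq_nonneg t]
end
end

section
/- Let K ⊆ ℝ^n be compact. For q_0 ∈ ℝ^n let γ_{q_0} denote the maximal solution of the equation of motion with γ_{q_0}(0) = q_0 and γ̇_{q_0}(0) = −B(q_0). Then, uniformly for q_0 ∈ K as t → 0⁺: (i) γ_{q_0} is defined on [0,t] and γ_{q_0}(t) = q_0 − t B(q_0) + O(t²); (ii) the action of γ_{q_0}|_{[0,t]} satisfies ∫_0^t (½|γ̇_{q_0}|² + B_i(γ_{q_0}) γ̇_{q_0}^i − C(γ_{q_0})) dτ = O(t); (iii) if moreover γ_{q_0}|_{[0,t]} belongs to a smooth family of nondegenerate classical paths with Hamilton function S_γ, then ((∂²(−S_γ)/∂q_1∂q_0)^{-1})^{kl}(t, q_0, γ_{q_0}(t)) = t δ^{kl} + O(t²) for all k, l, where the inverse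 matrix is defined by ((∂²(−S_γ)/∂q_1∂q_0)^{-1})^{kl} · ∂²(−S_γ)/∂q_0^l∂q_1^m = δ^k_m. -/
open MeasureTheory Set
open scoped BigOperators

noncomputable section

section FlowPart

open Filter Topology

theorem lip_ball {E F : Type} [NormedAddCommGroup E] [NormedSpace ℝ E] [ProperSpace E]
    [NormedAddCommGroup F] [NormedSpace ℝ F] {f : E → F} (hf : ContDiff ℝ (⊤ : ℕ∞) f) (R : ℝ) :
    ∃ L : NNReal, LipschitzOnWith L f (Metric.closedBall 0 R) := by
  have h1 : LocallyLipschitz f := (hf.of_le (by simp)).locallyLipschitz (𝕂 := ℝ)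
  exact (h1.locallyLipschitzOn).exists_lipschitzOnWith_of_compact (isCompact_closedBall 0 R)

theorem bdd_ball {E F : Type} [NormedAddCommGroup E] [ProperSpace E]
    [NormedAddCommGroup F] {f : E → F} (hf : Continuous f) (R : ℝ) :
    ∃ M : ℝ, 0 < M ∧ ∀ x, ‖x‖ ≤ R → ‖f x‖ ≤ M := by
  obtain ⟨M, hM⟩ := (isCompact_closedBall (0:E) R).exists_bound_of_continuousOn hf.continuousOn
  refine ⟨max M 1, by positivity, fun x hx => (hM x (by simpa using hx)).trans (le_max_left _ _)⟩

theorem quad_ball {E F : Type} [NormedAddCommGroup E] [NormedSpace ℝ E] [ProperSpace E]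
    [NormedAddCommGroup F] [NormedSpace ℝ F] {f : E → F} (hf : ContDiff ℝ (⊤ : ℕ∞) f) (R : ℝ) :
    ∃ M : ℝ, 0 ≤ M ∧ ∀ x y, ‖x‖ ≤ R → ‖y‖ ≤ R →
      ‖f y - f x - fderiv ℝ f x (y - x)‖ ≤ M * ‖y - x‖ ^ 2 := by
  have h1 : ContDiff ℝ (⊤ : ℕ∞) (fderiv ℝ f) := hf.fderiv_right (by simp)
  obtain ⟨L, hL⟩ := lip_ball h1 R
  refine ⟨L, L.2, fun x y hx hy => ?_⟩
  have hseg : segment ℝ x y ⊆ Metric.closedBall (0:E) R :=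
    (convex_closedBall (0:E) R).segment_subset (by simpa using hx) (by simpa using hy)
  have := (convex_segment x y).norm_image_sub_le_of_norm_hasFDerivWithin_le'
    (f := f) (f' := fderiv ℝ f) (φ := fderiv ℝ f x) (C := L * ‖y - x‖) (𝕜 := ℝ)
    (fun z _ => ((hf.differentiable (by simp)) z).hasFDerivAt.hasFDerivWithinAt)
    (fun z hz => by
      have h := hL.dist_le_mul z (hseg hz) x (by simpa using hx)
      rw [dist_eq_norm, dist_eq_norm] at h
      refine h.trans (mul_le_mul_of_nonneg_left ?_ L.2)
      have := norm_sub_le_of_mem_segment hz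
      simpa using this)
    (left_mem_segment ℝ x y) (right_mem_segment ℝ x y)
  rw [pow_two, ← mul_assoc]; exact this

theorem hasFDerivAt_of_quad {E F : Type} [NormedAddCommGroup E] [NormedSpace ℝ E]
    [NormedAddCommGroup F] [NormedSpace ℝ F] {f : E → F} {x : E} {f' : E →L[ℝ] F} {M : ℝ}
    (h : ∀ᶠ y in 𝓝 x, ‖f y - f x - f' (y - x)‖ ≤ M * ‖y - x‖ ^ 2) : HasFDerivAt f f' x := by
  refine HasFDerivAt.of_isLittleO ?_
  refine Asymptotics.IsBigO.trans_isLittleO ?_ (Asymptotics.isLittleO_pow_sub_sub x one_lt_two)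
  refine Asymptotics.IsBigO.of_bound M ?_
  filter_upwards [h] with y hy
  simpa using hy

abbrev XX (E : Type) [NormedAddCommGroup E] := C(Set.Icc (0:ℝ) 1, E)

def Bil (E F : Type) [NormedAddCommGroup E] [NormedSpace ℝ E]
    [NormedAddCommGroup F] [NormedSpace ℝ F] : XX (E →L[ℝ] F) →L[ℝ] XX E →L[ℝ] XX F :=
  LinearMap.mkContinuous₂
    (LinearMap.mk₂ ℝ (fun (A : XX (E →L[ℝ] F)) (h : XX E) =>
      (⟨fun s => A s (h s), A.continuous.clm_apply h.continuous⟩ : XX F))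
      (fun _ _ _ => by ext; simp) (fun _ _ _ => by ext; simp)
      (fun _ _ _ => by ext; simp) (fun _ _ _ => by ext; simp)) 1
    (fun A h => by
      rw [one_mul, ContinuousMap.norm_le _ (by positivity)]
      intro s
      refine ((A s).le_opNorm (h s)).trans ?_
      exact mul_le_mul (A.norm_coe_le_norm s) (h.norm_coe_le_norm s) (norm_nonneg _) (norm_nonneg _))

theorem Bil_apply {E F : Type} [NormedAddCommGroup E] [NormedSpace ℝ E]
    [NormedAddCommGroup F] [NormedSpace ℝ F] (A : XX (E →L[ℝ] F)) (h : XX E) (s) :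
    Bil E F A h s = A s (h s) := rfl

def Nem {E F : Type} [NormedAddCommGroup E] [NormedAddCommGroup F] (f : E → F)
    (hf : Continuous f) (α : XX E) : XX F := ⟨fun s => f (α s), hf.comp α.continuous⟩

theorem Nem_hasFDerivAt {E F : Type} [NormedAddCommGroup E] [NormedSpace ℝ E] [ProperSpace E]
    [NormedAddCommGroup F] [NormedSpace ℝ F] {f : E → F} (hf : ContDiff ℝ (⊤ : ℕ∞) f)
    (hf' : Continuous (fderiv ℝ f)) (α : XX E) :
    HasFDerivAt (Nem f hf.continuous) (Bil E F (Nem (fderiv ℝ f) hf' α)) α := by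
  obtain ⟨M, hM0, hM⟩ := quad_ball hf (‖α‖ + 1)
  refine hasFDerivAt_of_quad (M := M) ?_
  filter_upwards [Metric.ball_mem_nhds α one_pos] with β hβ
  rw [ContinuousMap.norm_le _ (by positivity)]
  intro s
  have h1 : ‖α s‖ ≤ ‖α‖ + 1 := (α.norm_coe_le_norm s).trans (by linarith)
  have h2 : ‖β s‖ ≤ ‖α‖ + 1 := by
    refine (β.norm_coe_le_norm s).trans ?_
    have : ‖β‖ ≤ ‖α‖ + ‖β - α‖ := by
      have := norm_add_le α (β - α); simpa using this
    have h3 : ‖β - α‖ < 1 := by rwa [← dist_eq_norm]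
    linarith
  refine (hM (α s) (β s) h1 h2).trans ?_
  have h4 : ‖β s - α s‖ ≤ ‖β - α‖ := (β - α).norm_coe_le_norm s
  gcongr

theorem Nem_contDiff_nat {E : Type} [NormedAddCommGroup E] [NormedSpace ℝ E] [ProperSpace E]
    (m : ℕ) : ∀ {F : Type} [NormedAddCommGroup F] [NormedSpace ℝ F] {f : E → F}
      (hf : ContDiff ℝ (⊤ : ℕ∞) f), ContDiff ℝ m (Nem f hf.continuous) := by
  induction m with
  | zero =>
    intro F _ _ f hf
    have : Continuous (Nem f hf.continuous) := by
      rw [continuous_iff_continuousAt]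
      intro α
      exact (Nem_hasFDerivAt hf (hf.continuous_fderiv (by simp)) α).continuousAt
    simpa using (contDiff_zero (𝕜 := ℝ)).2 this
  | succ m ih =>
    intro F _ _ f hf
    have h1 : ContDiff ℝ (⊤ : ℕ∞) (fderiv ℝ f) := hf.fderiv_right (by simp)
    have h2 := fun α => Nem_hasFDerivAt hf h1.continuous α
    push_cast
    rw [contDiff_succ_iff_fderiv]
    refine ⟨fun α => (h2 α).differentiableAt, by simp, ?_⟩
    have h3 : fderiv ℝ (Nem f hf.continuous) = fun α => Bil E F (Nem (fderiv ℝ f) h1.continuous α) := by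
      ext1 α; exact (h2 α).fderiv
    rw [h3]
    have h4 : ContDiff ℝ m (Bil E F) :=
      ContinuousLinearMap.contDiff (𝕜 := ℝ) (E := XX (E →L[ℝ] F)) (F := XX E →L[ℝ] XX F) (Bil E F)
    exact h4.comp (ih h1)

theorem Nem_contDiff {E : Type} [NormedAddCommGroup E] [NormedSpace ℝ E] [ProperSpace E]
    {F : Type} [NormedAddCommGroup F] [NormedSpace ℝ F] {f : E → F}
      (hf : ContDiff ℝ (⊤ : ℕ∞) f) : ContDiff ℝ (⊤ : ℕ∞) (Nem f hf.continuous) :=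
  contDiff_infty.2 fun m => Nem_contDiff_nat m hf

def ext01 {E : Type} [NormedAddCommGroup E] (β : XX E) : ℝ → E :=
  fun u => β (Set.projIcc 0 1 zero_le_one u)

theorem ext01_cont {E : Type} [NormedAddCommGroup E] (β : XX E) : Continuous (ext01 β) :=
  β.continuous.comp continuous_projIcc

def Jop (E : Type) [NormedAddCommGroup E] [NormedSpace ℝ E] [CompleteSpace E] : XX E →L[ℝ] XX E :=
  LinearMap.mkContinuous
    { toFun := fun β => ⟨fun s => ∫ u in (0:ℝ)..s, ext01 β u,
        (intervalIntegral.continuous_primitive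
          (fun a b => (ext01_cont β).intervalIntegrable a b) 0).comp continuous_subtype_val⟩
      map_add' := fun β β' => by
        ext s
        exact intervalIntegral.integral_add ((ext01_cont β).intervalIntegrable _ _)
          ((ext01_cont β').intervalIntegrable _ _)
      map_smul' := fun c β => by
        ext s
        exact intervalIntegral.integral_smul c (ext01 β) } 1
    (fun β => by
      rw [one_mul, ContinuousMap.norm_le _ (by positivity)]
      intro s
      have := intervalIntegral.norm_integral_le_of_norm_le_const (a := 0) (b := s.1) (f := ext01 β)
        (C := ‖β‖) (fun x _ => β.norm_coe_le_norm _)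
      refine this.trans ?_
      have hs : |s.1 - 0| ≤ 1 := by
        rw [sub_zero, abs_of_nonneg s.2.1]; exact s.2.2
      nlinarith [norm_nonneg β])

theorem Jop_apply {E : Type} [NormedAddCommGroup E] [NormedSpace ℝ E] [CompleteSpace E]
    (β : XX E) (s) : Jop E β s = ∫ u in (0:ℝ)..s, ext01 β u := rfl

theorem Jop_norm {E : Type} [NormedAddCommGroup E] [NormedSpace ℝ E] [CompleteSpace E]
    (β : XX E) : ‖Jop E β‖ ≤ ‖β‖ := by
  have := (Jop E).le_of_opNorm_le (LinearMap.mkContinuous_norm_le _ zero_le_one _) β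
  simpa using this

def constL (E : Type) [NormedAddCommGroup E] [NormedSpace ℝ E] : E →L[ℝ] XX E :=
  LinearMap.mkContinuous
    { toFun := fun x => ContinuousMap.const _ x
      map_add' := fun _ _ => by ext; simp
      map_smul' := fun _ _ => by ext; simp } 1
    (fun x => by
      rw [one_mul, ContinuousMap.norm_le _ (by positivity)]
      intro s; simp)

theorem constL_apply {E : Type} [NormedAddCommGroup E] [NormedSpace ℝ E] (x : E) (s) :
    constL E x s = x := rfl

def Psi {E : Type} [NormedAddCommGroup E] [NormedSpace ℝ E] [CompleteSpace E] (f : E → E)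
    (hf : Continuous f) (p : ℝ × E × XX E) : ℝ × E × XX E :=
  (p.1, p.2.1, p.2.2 - constL E p.2.1 - p.1 • Jop E (Nem f hf p.2.2))

theorem Psi_contDiff {E : Type} [NormedAddCommGroup E] [NormedSpace ℝ E] [ProperSpace E]
    [CompleteSpace E] {f : E → E} (hf : ContDiff ℝ (⊤ : ℕ∞) f) :
    ContDiff ℝ (⊤ : ℕ∞) (Psi f hf.continuous) := by
  unfold Psi
  have h1 : ContDiff ℝ (⊤ : ℕ∞) (fun p : ℝ × E × XX E => Nem f hf.continuous p.2.2) :=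
    (Nem_contDiff hf).comp (contDiff_snd.comp contDiff_snd)
  have h2 : ContDiff ℝ (⊤ : ℕ∞) (fun p : ℝ × E × XX E => Jop E (Nem f hf.continuous p.2.2)) :=
    (ContinuousLinearMap.contDiff (𝕜 := ℝ) (E := XX E) (F := XX E) (Jop E)).comp h1
  have h3 : ContDiff ℝ (⊤ : ℕ∞) (fun p : ℝ × E × XX E => constL E p.2.1) :=
    (ContinuousLinearMap.contDiff (𝕜 := ℝ) (E := E) (F := XX E) (constL E)).comp
      (contDiff_fst.comp contDiff_snd)
  exact contDiff_fst.prodMk ((contDiff_fst.comp contDiff_snd).prodMk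
    (((contDiff_snd.comp contDiff_snd).sub h3).sub (contDiff_fst.smul h2)))

/-- The derivative of `Psi` at `(0, x, α)`. -/
def dPsi (E : Type) [NormedAddCommGroup E] [NormedSpace ℝ E] (b : XX E) :
    (ℝ × E × XX E) →L[ℝ] (ℝ × E × XX E) :=
  (ContinuousLinearMap.fst ℝ ℝ (E × XX E)).prod
    (((ContinuousLinearMap.fst ℝ E (XX E)).comp (ContinuousLinearMap.snd ℝ ℝ (E × XX E))).prod
      (((ContinuousLinearMap.snd ℝ E (XX E)).comp (ContinuousLinearMap.snd ℝ ℝ (E × XX E)))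
        - (constL E).comp ((ContinuousLinearMap.fst ℝ E (XX E)).comp
            (ContinuousLinearMap.snd ℝ ℝ (E × XX E)))
        - (ContinuousLinearMap.fst ℝ ℝ (E × XX E)).smulRight b))

def dPsiInv (E : Type) [NormedAddCommGroup E] [NormedSpace ℝ E] (b : XX E) :
    (ℝ × E × XX E) →L[ℝ] (ℝ × E × XX E) :=
  (ContinuousLinearMap.fst ℝ ℝ (E × XX E)).prod
    (((ContinuousLinearMap.fst ℝ E (XX E)).comp (ContinuousLinearMap.snd ℝ ℝ (E × XX E))).prod
      (((ContinuousLinearMap.snd ℝ E (XX E)).comp (ContinuousLinearMap.snd ℝ ℝ (E × XX E)))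
        + (constL E).comp ((ContinuousLinearMap.fst ℝ E (XX E)).comp
            (ContinuousLinearMap.snd ℝ ℝ (E × XX E)))
        + (ContinuousLinearMap.fst ℝ ℝ (E × XX E)).smulRight b))

def dPsiEquiv (E : Type) [NormedAddCommGroup E] [NormedSpace ℝ E] (b : XX E) :
    (ℝ × E × XX E) ≃L[ℝ] (ℝ × E × XX E) :=
  ContinuousLinearEquiv.equivOfInverse (dPsi E b) (dPsiInv E b)
    (fun p => by
      obtain ⟨a, x, α⟩ := p
      simp [dPsi, dPsiInv]
      abel)
    (fun p => by
      obtain ⟨a, x, α⟩ := p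
      simp [dPsi, dPsiInv]
      abel)

theorem Psi_hasFDerivAt {E : Type} [NormedAddCommGroup E] [NormedSpace ℝ E] [ProperSpace E]
    [CompleteSpace E] {f : E → E} (hf : ContDiff ℝ (⊤ : ℕ∞) f) (x : E) (α : XX E) :
    HasFDerivAt (Psi f hf.continuous) (dPsi E (Jop E (Nem f hf.continuous α))) (0, x, α) := by
  have h1 : DifferentiableAt ℝ (fun p : ℝ × E × XX E => Jop E (Nem f hf.continuous p.2.2))
      (0, x, α) := by
    have h1 : ContDiff ℝ (⊤ : ℕ∞) (fun p : ℝ × E × XX E => Nem f hf.continuous p.2.2) :=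
      (Nem_contDiff hf).comp (contDiff_snd.comp contDiff_snd)
    have h2 : ContDiff ℝ (⊤ : ℕ∞) (fun p : ℝ × E × XX E => Jop E (Nem f hf.continuous p.2.2)) :=
      (ContinuousLinearMap.contDiff (𝕜 := ℝ) (E := XX E) (F := XX E) (Jop E)).comp h1
    exact h2.differentiable (by simp) _
  have hs := (hasFDerivAt_fst (𝕜 := ℝ) (p := ((0, x, α) : ℝ × E × XX E))).smul h1.hasFDerivAt
  have hA := ((ContinuousLinearMap.snd ℝ E (XX E)).comp
    (ContinuousLinearMap.snd ℝ ℝ (E × XX E))).hasFDerivAt (x := ((0, x, α) : ℝ × E × XX E))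
  have hX := ((ContinuousLinearMap.fst ℝ E (XX E)).comp
    (ContinuousLinearMap.snd ℝ ℝ (E × XX E))).hasFDerivAt (x := ((0, x, α) : ℝ × E × XX E))
  have hC := ((constL E).comp ((ContinuousLinearMap.fst ℝ E (XX E)).comp
            (ContinuousLinearMap.snd ℝ ℝ (E × XX E)))).hasFDerivAt
              (x := ((0, x, α) : ℝ × E × XX E))
  have := (hasFDerivAt_fst (𝕜 := ℝ) (p := ((0, x, α) : ℝ × E × XX E))).prodMk
    (hX.prodMk ((hA.sub hC).sub hs))
  convert! this using 1
  ext p <;> simp [dPsi]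

/-- `Φ` is a smooth bounded local flow of the vector field `f` on `W × (-ε, ε)`. -/
structure FlowOn {E : Type} [NormedAddCommGroup E] [NormedSpace ℝ E] (f : E → E) (W : Set E)
    (ε M : ℝ) (Φ : E → ℝ → E) : Prop where
  smooth : ContDiffOn ℝ (⊤ : ℕ∞) (fun p : E × ℝ => Φ p.1 p.2) (W ×ˢ Ioo (-ε) ε)
  atzero : ∀ x ∈ W, Φ x 0 = x
  ode : ∀ x ∈ W, ∀ τ ∈ Ioo (-ε) ε, HasDerivAt (Φ x) (f (Φ x τ)) τ
  bdd : ∀ x ∈ W, ∀ τ ∈ Ioo (-ε) ε, ‖Φ x τ‖ ≤ M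

/-- Uniqueness of fixed points of the scaled Picard map. -/
theorem picard_unique {E : Type} [NormedAddCommGroup E] [NormedSpace ℝ E]
    [CompleteSpace E] {f : E → E} (hf : Continuous f) {R : ℝ} {L : NNReal}
    (hL : LipschitzOnWith L f (Metric.closedBall 0 R)) {t : ℝ} (ht : |t| * L ≤ 1 / 2)
    {x : E} {α β : XX E} (hα : ‖α‖ ≤ R) (hβ : ‖β‖ ≤ R)
    (h1 : α = constL E x + t • Jop E (Nem f hf α))
    (h2 : β = constL E x + t • Jop E (Nem f hf β)) : α = β := by
  have h3 : α - β = t • Jop E (Nem f hf α - Nem f hf β) := by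
    rw [map_sub, smul_sub]
    nth_rewrite 1 [h1]
    nth_rewrite 1 [h2]
    abel
  have h4 : ‖Nem f hf α - Nem f hf β‖ ≤ L * ‖α - β‖ := by
    rw [ContinuousMap.norm_le _ (by positivity)]
    intro s
    have h5 := hL.dist_le_mul (α s) (by simpa using (α.norm_coe_le_norm s).trans hα)
      (β s) (by simpa using (β.norm_coe_le_norm s).trans hβ)
    rw [dist_eq_norm, dist_eq_norm] at h5
    refine h5.trans (mul_le_mul_of_nonneg_left ?_ L.2)
    exact (α - β).norm_coe_le_norm s
  have h6 : ‖α - β‖ ≤ |t| * (L * ‖α - β‖) := by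
    calc ‖α - β‖ = ‖t • Jop E (Nem f hf α - Nem f hf β)‖ := by rw [← h3]
      _ = |t| * ‖Jop E (Nem f hf α - Nem f hf β)‖ := by rw [norm_smul, Real.norm_eq_abs]
      _ ≤ _ := mul_le_mul_of_nonneg_left ((Jop_norm _).trans h4) (abs_nonneg t)
  have h7 : ‖α - β‖ ≤ 0 := by nlinarith [norm_nonneg (α - β)]
  exact sub_eq_zero.1 (norm_le_zero_iff.1 h7)

def reparam {E : Type} [NormedAddCommGroup E] (s : Icc (0:ℝ) 1) (α : XX E) : XX E :=
  ⟨fun u => α ⟨s.1 * u.1, mul_nonneg s.2.1 u.2.1, mul_le_one₀ s.2.2 u.2.1 u.2.2⟩, by fun_prop⟩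

theorem reparam_fix {E : Type} [NormedAddCommGroup E] [NormedSpace ℝ E]
    [CompleteSpace E] {f : E → E} (hf : Continuous f) {t : ℝ}
    {x : E} {α : XX E} (h1 : α = constL E x + t • Jop E (Nem f hf α)) (s : Icc (0:ℝ) 1) :
    reparam s α = constL E x + (t * s.1) • Jop E (Nem f hf (reparam s α)) := by
  ext u
  have h2 : reparam s α u = x + t • ∫ v in (0:ℝ)..(s.1 * u.1), ext01 (Nem f hf α) v := by
    change α _ = _
    nth_rewrite 1 [h1]
    rfl
  rw [h2]
  change _ = x + (t * s.1) • ∫ v in (0:ℝ)..u.1, ext01 (Nem f hf (reparam s α)) v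
  have h3 : ∫ v in (0:ℝ)..u.1, ext01 (Nem f hf (reparam s α)) v
      = ∫ v in (0:ℝ)..u.1, ext01 (Nem f hf α) (s.1 * v) := by
    refine intervalIntegral.integral_congr fun v hv => ?_
    rw [uIcc_of_le u.2.1] at hv
    have hv1 : v ∈ Icc (0:ℝ) 1 := ⟨hv.1, hv.2.trans u.2.2⟩
    have hv2 : s.1 * v ∈ Icc (0:ℝ) 1 :=
      ⟨mul_nonneg s.2.1 hv1.1, mul_le_one₀ s.2.2 hv1.1 hv1.2⟩
    simp only [ext01]
    rw [projIcc_of_mem _ hv1, projIcc_of_mem _ hv2]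
    rfl
  rw [h3, mul_smul, intervalIntegral.smul_integral_comp_mul_left, mul_zero]

theorem local_flow {E : Type} [NormedAddCommGroup E] [NormedSpace ℝ E] [ProperSpace E]
    [CompleteSpace E] {f : E → E} (hf : ContDiff ℝ (⊤ : ℕ∞) f) (x0 : E) :
    ∃ δ > 0, ∃ U : Set E, IsOpen U ∧ x0 ∈ U ∧ ∃ M Φ, FlowOn f U δ M Φ := by
  set α0 : XX E := constL E x0 with hα0
  have hΨ := Psi_contDiff hf
  have hd := Psi_hasFDerivAt hf x0 α0
  set b := Jop E (Nem f hf.continuous α0) with hb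
  have hstrict : HasStrictFDerivAt (Psi f hf.continuous)
      ((dPsiEquiv E b : (ℝ × E × XX E) ≃L[ℝ] (ℝ × E × XX E)) :
        (ℝ × E × XX E) →L[ℝ] (ℝ × E × XX E)) (0, x0, α0) :=
    (hΨ.contDiffAt).hasStrictFDerivAt' hd (by simp)
  set e := hstrict.toOpenPartialHomeomorph (Psi f hf.continuous) with he
  have hecoe : ∀ p, e p = Psi f hf.continuous p := fun p => rfl
  have hmem : ((0, x0, α0) : ℝ × E × XX E) ∈ e.source :=
    hstrict.mem_toOpenPartialHomeomorph_source
  have hval : Psi f hf.continuous (0, x0, α0) = (0, x0, 0) := by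
    simp [Psi, hα0]
  have htar : ((0, x0, 0) : ℝ × E × XX E) ∈ e.target := by
    rw [← hval]; exact e.map_source hmem
  have hsym : e.symm (0, x0, 0) = (0, x0, α0) := by
    rw [← hval]; exact e.left_inv hmem
  have hcs : ContinuousAt e.symm (0, x0, 0) := e.continuousAt_symm htar
  have hev1 : ∀ᶠ y in 𝓝 ((0, x0, 0) : ℝ × E × XX E), y ∈ e.target := e.open_target.mem_nhds htar
  have hev2 : ∀ᶠ y in 𝓝 ((0, x0, 0) : ℝ × E × XX E),
      fderiv ℝ (Psi f hf.continuous) (e.symm y) ∈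
        range (ContinuousLinearEquiv.toContinuousLinearMap :
          ((ℝ × E × XX E) ≃L[ℝ] (ℝ × E × XX E)) → _) := by
    have hc : ContinuousAt (fun y => fderiv ℝ (Psi f hf.continuous) (e.symm y)) (0, x0, 0) :=
      ContinuousAt.comp (g := fderiv ℝ (Psi f hf.continuous))
        (hΨ.continuous_fderiv (by simp)).continuousAt hcs
    refine hc.eventually_mem ?_
    rw [hsym, hd.fderiv]
    exact (dPsiEquiv E b).nhds
  have hev3 : ∀ᶠ y in 𝓝 ((0, x0, 0) : ℝ × E × XX E), ‖(e.symm y).2.2‖ < ‖α0‖ + 1 := by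
    have hc : ContinuousAt (fun y => ‖(e.symm y).2.2‖) (0, x0, 0) := by
      have := (continuous_snd.comp continuous_snd).norm.continuousAt.comp hcs
      exact this
    refine hc.eventually_lt continuousAt_const ?_
    rw [hsym]; simp
  have hι : ContinuousAt (fun p : ℝ × E => ((p.1, p.2, 0) : ℝ × E × XX E)) (0, x0) := by fun_prop
  have hev := hι.eventually (hev1.and (hev2.and hev3))
  obtain ⟨V1, V2, hV1, h01, hV2, h02, hV⟩ := mem_nhds_prod_iff'.1 hev
  obtain ⟨δ1, hδ1, hδV⟩ := Metric.isOpen_iff.1 hV1 0 h01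
  set R := ‖α0‖ + 1 with hR
  obtain ⟨L, hL⟩ := lip_ball hf R
  set δ := min δ1 (1 / (2 * ((L:ℝ) + 1))) with hδ
  have hδpos : 0 < δ := lt_min hδ1 (by positivity)
  set a : ℝ → E → XX E := fun t x => (e.symm (t, x, 0)).2.2 with ha
  have hgood : ∀ t ∈ Ioo (-δ) δ, ∀ x ∈ V2, (t, x, 0) ∈ e.target ∧
      (fderiv ℝ (Psi f hf.continuous) (e.symm (t, x, 0)) ∈
        range (ContinuousLinearEquiv.toContinuousLinearMap :
          ((ℝ × E × XX E) ≃L[ℝ] (ℝ × E × XX E)) → _)) ∧ ‖a t x‖ < R := by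
    intro t ht x hx
    refine hV (show (t, x) ∈ V1 ×ˢ V2 from ⟨hδV ?_, hx⟩)
    rw [Metric.mem_ball, dist_zero_right, Real.norm_eq_abs, abs_lt]
    have : δ ≤ δ1 := min_le_left _ _
    exact ⟨by linarith [ht.1], by linarith [ht.2]⟩
  have hfix : ∀ t ∈ Ioo (-δ) δ, ∀ x ∈ V2,
      a t x = constL E x + t • Jop E (Nem f hf.continuous (a t x)) := by
    intro t ht x hx
    have h1 := e.right_inv (hgood t ht x hx).1
    rw [hecoe] at h1
    have h2 := congrArg Prod.fst h1
    have h3 := congrArg (fun p => p.2.1) h1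
    have h4 := congrArg (fun p => p.2.2) h1
    simp only [Psi] at h2 h3 h4
    rw [h2, h3, sub_sub] at h4
    exact sub_eq_zero.1 h4
  have hsm : ∀ t ∈ Ioo (-δ) δ, |t| * L ≤ 1 / 2 := by
    intro t ht
    have h1 : |t| ≤ 1 / (2 * ((L:ℝ) + 1)) := (abs_lt.2 ht).le.trans (min_le_right _ _)
    have hL0 : (0:ℝ) ≤ L := L.2
    calc |t| * L ≤ 1 / (2 * ((L:ℝ) + 1)) * L := mul_le_mul_of_nonneg_right h1 hL0
      _ ≤ 1 / 2 := by rw [div_mul_eq_mul_div, div_le_div_iff₀ (by positivity) (by positivity)]; linarith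
  have hmul : ∀ t ∈ Ioo (-δ) δ, ∀ s ∈ Icc (0:ℝ) 1, t * s ∈ Ioo (-δ) δ := by
    intro t ht s hs
    rw [mem_Ioo, ← abs_lt, abs_mul, abs_of_nonneg hs.1]
    have := abs_lt.2 ht
    nlinarith [abs_nonneg t, hs.2, hs.1]
  set Φ : E → ℝ → E := fun x t => a t x ⟨1, zero_le_one, le_rfl⟩ with hΦ
  have hrel : ∀ t ∈ Ioo (-δ) δ, ∀ x ∈ V2, ∀ s : Icc (0:ℝ) 1, a t x s = Φ x (t * s.1) := by
    intro t ht x hx s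
    have hts := hmul t ht s.1 s.2
    have h1 := reparam_fix hf.continuous (hfix t ht x hx) s
    have h2 := hfix _ hts x hx
    have hn : ‖reparam s (a t x)‖ ≤ R := by
      rw [ContinuousMap.norm_le _ (by positivity)]
      intro u
      exact ((a t x).norm_coe_le_norm _).trans (hgood t ht x hx).2.2.le
    have h3 := picard_unique hf.continuous hL (hsm _ hts) hn (hgood _ hts x hx).2.2.le h1 h2
    have h4 := congrArg (fun α : XX E => α ⟨1, zero_le_one, le_rfl⟩) h3
    simp only [reparam, ContinuousMap.coe_mk, mul_one] at h4
    exact h4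
  have hsmooth : ContDiffOn ℝ (⊤ : ℕ∞) (fun p : E × ℝ => Φ p.1 p.2) (V2 ×ˢ Ioo (-δ) δ) := by
    rintro ⟨x, t⟩ ⟨hx, ht⟩
    obtain ⟨g1, ⟨e', he'⟩, -⟩ := hgood t ht x hx
    have hcd : ContDiffAt ℝ (⊤ : ℕ∞) e.symm (t, x, 0) := by
      refine e.contDiffAt_symm (f₀' := e') g1 ?_ hΨ.contDiffAt
      rw [he']
      exact (hΨ.differentiable (by simp) _).hasFDerivAt
    have hin : ContDiffAt ℝ (⊤ : ℕ∞) (fun p : E × ℝ => ((p.2, p.1, 0) : ℝ × E × XX E)) (x, t) :=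
      (contDiff_snd.prodMk (contDiff_fst.prodMk contDiff_const)).contDiffAt
    have h1 := hcd.comp (x, t) hin
    have h2 : ContDiffAt ℝ (⊤ : ℕ∞) (fun p : E × ℝ => a p.2 p.1) (x, t) :=
      contDiffAt_snd.comp (x, t) (contDiffAt_snd.comp (x, t) h1)
    have h3 : ContDiff ℝ (⊤ : ℕ∞) (ContinuousMap.evalCLM (M := E) ℝ (⟨1, zero_le_one, le_rfl⟩ : Icc (0:ℝ) 1)) :=
      ContinuousLinearMap.contDiff (𝕜 := ℝ) (E := XX E) (F := E) _
    exact (h3.contDiffAt.comp (x, t) h2).contDiffWithinAt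
  have hbdd : ∀ x ∈ V2, ∀ τ ∈ Ioo (-δ) δ, ‖Φ x τ‖ ≤ R := fun x hx τ hτ =>
    ((a τ x).norm_coe_le_norm _).trans (hgood τ hτ x hx).2.2.le
  have hint : ∀ x ∈ V2, ∀ τ ∈ Ioo (-δ) δ, Φ x τ = x + ∫ u in (0:ℝ)..τ, f (Φ x u) := by
    intro x hx τ hτ
    have h1 : Φ x τ = x + τ • ∫ v in (0:ℝ)..1, ext01 (Nem f hf.continuous (a τ x)) v := by
      change a τ x _ = _
      nth_rewrite 1 [hfix τ hτ x hx]
      rfl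
    have h3 : ∫ v in (0:ℝ)..1, ext01 (Nem f hf.continuous (a τ x)) v
        = ∫ v in (0:ℝ)..1, f (Φ x (τ * v)) := by
      refine intervalIntegral.integral_congr fun v hv => ?_
      rw [uIcc_of_le zero_le_one] at hv
      simp only [ext01]
      rw [projIcc_of_mem _ hv]
      change f (a τ x ⟨v, hv⟩) = _
      rw [hrel τ hτ x hx]
    rw [h1, h3, intervalIntegral.smul_integral_comp_mul_left (fun u => f (Φ x u)), mul_zero, mul_one]
  have hcont : ∀ x ∈ V2, ContinuousOn (fun u => f (Φ x u)) (Ioo (-δ) δ) := by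
    intro x hx
    refine hf.continuous.comp_continuousOn ?_
    exact hsmooth.continuousOn.comp (f := fun u : ℝ => (x, u)) (by fun_prop) (fun u hu => ⟨hx, hu⟩)
  refine ⟨δ, hδpos, V2, hV2, h02, R, Φ, hsmooth, ?_, ?_, hbdd⟩
  · intro x hx
    rw [hint x hx 0 ⟨by linarith, hδpos⟩]; simp
  · intro x hx τ hτ
    have hFTC : HasDerivAt (fun τ => ∫ u in (0:ℝ)..τ, f (Φ x u)) (f (Φ x τ)) τ := by
      have h0 : (0:ℝ) ∈ Ioo (-δ) δ := ⟨by linarith, hδpos⟩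
      refine intervalIntegral.integral_hasDerivAt_right ?_ ?_ ?_
      · refine ContinuousOn.intervalIntegrable ((hcont x hx).mono ?_)
        exact (ordConnected_Ioo).uIcc_subset h0 hτ
      · exact (hcont x hx).stronglyMeasurableAtFilter isOpen_Ioo τ hτ
      · exact (hcont x hx).continuousAt (isOpen_Ioo.mem_nhds hτ)
    refine (hFTC.const_add x).congr_of_eventuallyEq ?_
    filter_upwards [isOpen_Ioo.mem_nhds hτ] with u hu
    exact hint x hx u hu

theorem sol_unique {E : Type} [NormedAddCommGroup E] [NormedSpace ℝ E] [ProperSpace E]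
    {f : E → E} (hf : ContDiff ℝ (⊤ : ℕ∞) f) {y g : ℝ → E} {a b s : ℝ}
    (hy : ∀ τ ∈ Icc a b, HasDerivAt y (f (y τ)) τ)
    (hg : ∀ τ ∈ Icc a b, HasDerivAt g (f (g τ)) τ) (hs : s ∈ Icc a b) (heq : y s = g s) :
    EqOn y g (Icc a b) := by
  have cy : ContinuousOn y (Icc a b) := fun τ hτ => (hy τ hτ).continuousAt.continuousWithinAt
  have cg : ContinuousOn g (Icc a b) := fun τ hτ => (hg τ hτ).continuousAt.continuousWithinAt
  obtain ⟨M1, hM1⟩ := isCompact_Icc.exists_bound_of_continuousOn cy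
  obtain ⟨M2, hM2⟩ := isCompact_Icc.exists_bound_of_continuousOn cg
  obtain ⟨L, hL⟩ := lip_ball hf (max M1 M2)
  have my : ∀ τ ∈ Icc a b, y τ ∈ Metric.closedBall (0:E) (max M1 M2) := fun τ hτ => by
    simpa using Or.inl (hM1 τ hτ)
  have mg : ∀ τ ∈ Icc a b, g τ ∈ Metric.closedBall (0:E) (max M1 M2) := fun τ hτ => by
    simpa using Or.inr (hM2 τ hτ)
  rw [← Icc_union_Icc_eq_Icc hs.1 hs.2]
  have hl : Icc a s ⊆ Icc a b := Icc_subset_Icc_right hs.2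
  have hr : Icc s b ⊆ Icc a b := Icc_subset_Icc_left hs.1
  refine EqOn.union ?_ ?_
  · exact ODE_solution_unique_of_mem_Icc_left (v := fun _ => f)
      (s := fun _ => Metric.closedBall (0:E) (max M1 M2)) (fun _ _ => hL) (cy.mono hl)
      (fun τ hτ => (hy τ (hl (Ioc_subset_Icc_self hτ))).hasDerivWithinAt)
      (fun τ hτ => my τ (hl (Ioc_subset_Icc_self hτ))) (cg.mono hl)
      (fun τ hτ => (hg τ (hl (Ioc_subset_Icc_self hτ))).hasDerivWithinAt)
      (fun τ hτ => mg τ (hl (Ioc_subset_Icc_self hτ))) heq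
  · exact ODE_solution_unique_of_mem_Icc_right (v := fun _ => f)
      (s := fun _ => Metric.closedBall (0:E) (max M1 M2)) (fun _ _ => hL) (cy.mono hr)
      (fun τ hτ => (hy τ (hr (Ico_subset_Icc_self hτ))).hasDerivWithinAt)
      (fun τ hτ => my τ (hr (Ico_subset_Icc_self hτ))) (cg.mono hr)
      (fun τ hτ => (hg τ (hr (Ico_subset_Icc_self hτ))).hasDerivWithinAt)
      (fun τ hτ => mg τ (hr (Ico_subset_Icc_self hτ))) heq

theorem FlowOn.eq_of_solution {E : Type} [NormedAddCommGroup E] [NormedSpace ℝ E] [ProperSpace E]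
    {f : E → E} (hf : ContDiff ℝ (⊤ : ℕ∞) f) {W : Set E} {ε M : ℝ} {Φ : E → ℝ → E}
    (hΦ : FlowOn f W ε M Φ) {y : ℝ → E} {t s : ℝ} (ht : t < ε)
    (hy : ∀ τ ∈ Icc 0 t, HasDerivAt y (f (y τ)) τ) (hs : s ∈ Icc 0 t) (hW : y s ∈ W) :
    ∀ τ ∈ Icc 0 t, y τ = Φ (y s) (τ - s) := by
  refine sol_unique hf hy (g := fun τ => Φ (y s) (τ - s)) ?_ hs ?_
  · intro τ hτ
    have h1 := hΦ.ode (y s) hW (τ - s) ⟨by linarith [hτ.1, hs.2], by linarith [hτ.2, hs.1]⟩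
    exact h1.comp_sub_const τ s
  · simp [hΦ.atzero _ hW]

theorem flow_agree {E : Type} [NormedAddCommGroup E] [NormedSpace ℝ E] [ProperSpace E]
    {f : E → E} (hf : ContDiff ℝ (⊤ : ℕ∞) f) {W₁ W₂ : Set E} {ε₁ ε₂ M₁ M₂ : ℝ} {Φ₁ Φ₂ : E → ℝ → E}
    (h₁ : FlowOn f W₁ ε₁ M₁ Φ₁) (h₂ : FlowOn f W₂ ε₂ M₂ Φ₂) {x : E} (hx₁ : x ∈ W₁) (hx₂ : x ∈ W₂)
    {τ : ℝ} (hτ : τ ∈ Ioo (-(min ε₁ ε₂)) (min ε₁ ε₂)) : Φ₁ x τ = Φ₂ x τ := by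
  have ha : |τ| < min ε₁ ε₂ := abs_lt.2 hτ
  have ha1 : |τ| < ε₁ := ha.trans_le (min_le_left _ _)
  have ha2 : |τ| < ε₂ := ha.trans_le (min_le_right _ _)
  refine sol_unique hf (a := -|τ|) (b := |τ|) (s := 0)
    (fun σ hσ => h₁.ode x hx₁ σ ⟨by linarith [hσ.1], by linarith [hσ.2]⟩)
    (fun σ hσ => h₂.ode x hx₂ σ ⟨by linarith [hσ.1], by linarith [hσ.2]⟩)
    ⟨by simp, by simp⟩ (by rw [h₁.atzero x hx₁, h₂.atzero x hx₂])
    ⟨neg_abs_le τ, le_abs_self τ⟩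

theorem flow_compact {E : Type} [NormedAddCommGroup E] [NormedSpace ℝ E] [ProperSpace E]
    [CompleteSpace E] {f : E → E} (hf : ContDiff ℝ (⊤ : ℕ∞) f) {K : Set E} (hK : IsCompact K) :
    ∃ ε > 0, ∃ W : Set E, IsOpen W ∧ K ⊆ W ∧ ∃ M Φ, FlowOn f W ε M Φ := by
  refine hK.induction_on (p := fun K => ∃ ε > 0, ∃ W : Set E, IsOpen W ∧ K ⊆ W ∧
    ∃ M Φ, FlowOn f W ε M Φ) ?_ ?_ ?_ ?_
  · refine ⟨1, one_pos, ∅, isOpen_empty, subset_rfl, 0, fun x _ => x, ?_, ?_, ?_, ?_⟩ <;> simp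
  · rintro s t hst ⟨ε, hε, W, hW, htW, h⟩
    exact ⟨ε, hε, W, hW, hst.trans htW, h⟩
  · rintro s t ⟨ε₁, hε₁, W₁, hW₁, hs, M₁, Φ₁, h₁⟩ ⟨ε₂, hε₂, W₂, hW₂, ht, M₂, Φ₂, h₂⟩
    classical
    have hI1 : Ioo (-(min ε₁ ε₂)) (min ε₁ ε₂) ⊆ Ioo (-ε₁) ε₁ :=
      Ioo_subset_Ioo (by simp) (by simp)
    have hI2 : Ioo (-(min ε₁ ε₂)) (min ε₁ ε₂) ⊆ Ioo (-ε₂) ε₂ :=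
      Ioo_subset_Ioo (by simp) (by simp)
    set Φ : E → ℝ → E := fun x τ => if x ∈ W₁ then Φ₁ x τ else Φ₂ x τ with hΦ
    have e1 : ∀ x ∈ W₁, ∀ τ, Φ x τ = Φ₁ x τ := fun x hx τ => by simp [hΦ, hx]
    have e2 : ∀ x ∈ W₂, ∀ τ ∈ Ioo (-(min ε₁ ε₂)) (min ε₁ ε₂), Φ x τ = Φ₂ x τ := by
      intro x hx τ hτ
      by_cases hx1 : x ∈ W₁
      · rw [e1 x hx1]; exact flow_agree hf h₁ h₂ hx1 hx hτ
      · simp [hΦ, hx1]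
    refine ⟨min ε₁ ε₂, lt_min hε₁ hε₂, W₁ ∪ W₂, hW₁.union hW₂, union_subset_union hs ht,
      max M₁ M₂, Φ, ?_, ?_, ?_, ?_⟩
    · rintro ⟨x, τ⟩ ⟨hx, hτ⟩
      rcases hx with hx | hx
      · have hn : W₁ ×ˢ Ioo (-ε₁) ε₁ ∈ 𝓝 (x, τ) := (hW₁.prod isOpen_Ioo).mem_nhds ⟨hx, hI1 hτ⟩
        refine ContDiffAt.contDiffWithinAt ?_
        refine (h₁.smooth.contDiffAt hn).congr_of_eventuallyEq ?_
        filter_upwards [hn] with p hp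
        exact e1 _ hp.1 _
      · have hn : W₂ ×ˢ Ioo (-(min ε₁ ε₂)) (min ε₁ ε₂) ∈ 𝓝 (x, τ) :=
          (hW₂.prod isOpen_Ioo).mem_nhds ⟨hx, hτ⟩
        refine ContDiffAt.contDiffWithinAt ?_
        refine ((h₂.smooth.mono (prod_mono_right hI2)).contDiffAt hn).congr_of_eventuallyEq ?_
        filter_upwards [hn] with p hp
        exact e2 _ hp.1 _ hp.2
    · rintro x (hx | hx)
      · rw [e1 x hx, h₁.atzero x hx]
      · rw [e2 x hx 0 ⟨by simp [hε₁, hε₂], by simp [hε₁, hε₂]⟩, h₂.atzero x hx]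
    · rintro x (hx | hx) τ hτ
      · have : Φ x = Φ₁ x := funext (e1 x hx)
        rw [this]; exact h₁.ode x hx τ (hI1 hτ)
      · rw [e2 x hx τ hτ]
        refine (h₂.ode x hx τ (hI2 hτ)).congr_of_eventuallyEq ?_
        filter_upwards [isOpen_Ioo.mem_nhds hτ] with u hu
        exact e2 x hx u hu
    · rintro x (hx | hx) τ hτ
      · rw [e1 x hx]; exact (h₁.bdd x hx τ (hI1 hτ)).trans (le_max_left _ _)
      · rw [e2 x hx τ hτ]; exact (h₂.bdd x hx τ (hI2 hτ)).trans (le_max_right _ _)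
  · intro x _
    obtain ⟨δ, hδ, U, hU, hx, h⟩ := local_flow hf x
    exact ⟨U, mem_nhdsWithin_of_mem_nhds (hU.mem_nhds hx), δ, hδ, U, hU, subset_rfl, h⟩

theorem FlowOn.lip {E : Type} [NormedAddCommGroup E] [NormedSpace ℝ E] [ProperSpace E]
    {f : E → E} (hf : ContDiff ℝ (⊤ : ℕ∞) f) {W : Set E} {ε M : ℝ} {Φ : E → ℝ → E}
    (hΦ : FlowOn f W ε M Φ) : ∃ Λ : ℝ, 0 < Λ ∧ ∀ x ∈ W, ∀ x' ∈ W, ∀ τ ∈ Ioo (-ε) ε,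
      ‖Φ x τ - Φ x' τ‖ ≤ Λ * ‖x - x'‖ := by
  obtain ⟨L, hL⟩ := lip_ball hf M
  refine ⟨Real.exp (L * ε), Real.exp_pos _, fun x hx x' hx' τ hτ => ?_⟩
  have hmem : ∀ x ∈ W, ∀ σ ∈ Ioo (-ε) ε, Φ x σ ∈ Metric.closedBall (0:E) M := fun x hx σ hσ => by
    simpa using hΦ.bdd x hx σ hσ
  have hd0 : dist (Φ x 0) (Φ x' 0) ≤ dist x x' := by rw [hΦ.atzero x hx, hΦ.atzero x' hx']
  have hexp : ∀ r : ℝ, r ≤ ε → dist x x' * Real.exp (L * (r - 0)) ≤ Real.exp (L * ε) * ‖x - x'‖ := by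
    intro r hr
    rw [dist_eq_norm, mul_comm, sub_zero]
    gcongr
  rw [← dist_eq_norm]
  rcases le_total 0 τ with h0 | h0
  · have hI : ∀ σ ∈ Icc 0 τ, σ ∈ Ioo (-ε) ε := fun σ hσ =>
      ⟨by linarith [hσ.1, hτ.2], by linarith [hσ.2, hτ.2]⟩
    have := dist_le_of_trajectories_ODE_of_mem (v := fun _ => f)
      (s := fun _ => Metric.closedBall (0:E) M) (K := L) (f := Φ x) (g := Φ x') (a := 0) (b := τ)
      (δ := dist x x') (fun _ _ => hL)
      (fun σ hσ => (hΦ.ode x hx σ (hI σ hσ)).continuousAt.continuousWithinAt)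
      (fun σ hσ => (hΦ.ode x hx σ (hI σ (Ico_subset_Icc_self hσ))).hasDerivWithinAt)
      (fun σ hσ => hmem x hx σ (hI σ (Ico_subset_Icc_self hσ)))
      (fun σ hσ => (hΦ.ode x' hx' σ (hI σ hσ)).continuousAt.continuousWithinAt)
      (fun σ hσ => (hΦ.ode x' hx' σ (hI σ (Ico_subset_Icc_self hσ))).hasDerivWithinAt)
      (fun σ hσ => hmem x' hx' σ (hI σ (Ico_subset_Icc_self hσ))) hd0 τ ⟨h0, le_rfl⟩
    exact this.trans (hexp τ hτ.2.le)
  · have hI : ∀ σ ∈ Icc 0 (-τ), -σ ∈ Ioo (-ε) ε := fun σ hσ =>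
      ⟨by linarith [hσ.2, hτ.1], by linarith [hσ.1, hτ.1]⟩
    have hder : ∀ x ∈ W, ∀ σ ∈ Icc 0 (-τ),
        HasDerivAt (fun σ => Φ x (-σ)) (-(f (Φ x (-σ)))) σ := by
      intro x hx σ hσ
      have h1 := (hΦ.ode x hx (-σ) (hI σ hσ)).scomp σ (hasDerivAt_neg σ)
      simpa [Function.comp_def] using h1
    have := dist_le_of_trajectories_ODE_of_mem (v := fun _ z => -(f z))
      (s := fun _ => Metric.closedBall (0:E) M) (K := L) (f := fun σ => Φ x (-σ))
      (g := fun σ => Φ x' (-σ)) (a := 0) (b := -τ)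
      (δ := dist x x') (fun _ _ => hL.neg)
      (fun σ hσ => (hder x hx σ hσ).continuousAt.continuousWithinAt)
      (fun σ hσ => (hder x hx σ (Ico_subset_Icc_self hσ)).hasDerivWithinAt)
      (fun σ hσ => hmem x hx _ (hI σ (Ico_subset_Icc_self hσ)))
      (fun σ hσ => (hder x' hx' σ hσ).continuousAt.continuousWithinAt)
      (fun σ hσ => (hder x' hx' σ (Ico_subset_Icc_self hσ)).hasDerivWithinAt)
      (fun σ hσ => hmem x' hx' _ (hI σ (Ico_subset_Icc_self hσ))) (by simpa using hd0)
      (-τ) ⟨by linarith, le_rfl⟩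
    simp only [neg_neg] at this
    exact this.trans (hexp (-τ) (by linarith [hτ.1]))

theorem taylor2 {F : Type} [NormedAddCommGroup F] [NormedSpace ℝ F] {g g' g'' : ℝ → F} {M δ t : ℝ}
    (h0 : g 0 = 0) (h0' : g' 0 = 0) (hg : ∀ s ∈ Ioo (-δ) δ, HasDerivAt g (g' s) s)
    (hg' : ∀ s ∈ Ioo (-δ) δ, HasDerivAt g' (g'' s) s) (hM : ∀ s ∈ Ioo (-δ) δ, ‖g'' s‖ ≤ M)
    (ht : t ∈ Ioo (-δ) δ) : ‖g t‖ ≤ M * t ^ 2 := by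
  have ha : |t| < δ := abs_lt.2 ht
  have hI : ∀ r, |r| ≤ |t| → Icc (-|r|) |r| ⊆ Ioo (-δ) δ := fun r hr s hs =>
    ⟨by linarith [hs.1], by linarith [hs.2]⟩
  have h1 : ∀ s ∈ Icc (-|t|) |t|, ‖g' s‖ ≤ M * |t| := by
    intro s hs
    have := (convex_Icc (-|t|) |t|).norm_image_sub_le_of_norm_hasDerivWithin_le (f := g')
      (f' := g'') (C := M) (x := 0) (y := s)
      (fun u hu => (hg' u (hI t le_rfl hu)).hasDerivWithinAt) (fun u hu => hM u (hI t le_rfl hu))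
      ⟨by simp, by simp⟩ hs
    rw [h0', sub_zero, sub_zero] at this
    have hM0 : 0 ≤ M := (norm_nonneg _).trans (hM t ht)
    exact this.trans (mul_le_mul_of_nonneg_left (by rw [Real.norm_eq_abs]; exact abs_le.2 hs) hM0)
  have := (convex_Icc (-|t|) |t|).norm_image_sub_le_of_norm_hasDerivWithin_le (f := g)
      (f' := g') (C := M * |t|) (x := 0) (y := t)
      (fun u hu => (hg u (hI t le_rfl hu)).hasDerivWithinAt) h1
      ⟨by simp, by simp⟩ ⟨neg_abs_le t, le_abs_self t⟩
  rw [h0, sub_zero, sub_zero, Real.norm_eq_abs, mul_assoc, ← pow_two, sq_abs] at this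
  exact this

end FlowPart

section MechPart

open Filter Topology

/-- The phase space vector field of the equation of motion. -/
def vf {n : ℕ} (B : Fin n → (Fin n → ℝ) → ℝ) (C : (Fin n → ℝ) → ℝ)
    (x : (Fin n → ℝ) × (Fin n → ℝ)) : (Fin n → ℝ) × (Fin n → ℝ) :=
  (x.2, fun i => -(∑ j, (pd (B i) j x.1 - pd (B j) i x.1) * x.2 j) - pd C i x.1)

/-- The Lagrangian. -/
def Lag {n : ℕ} (B : Fin n → (Fin n → ℝ) → ℝ) (C : (Fin n → ℝ) → ℝ)
    (x : (Fin n → ℝ) × (Fin n → ℝ)) : ℝ :=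
  (1:ℝ)/2 * ∑ i, x.2 i ^ 2 + ∑ i, B i x.1 * x.2 i - C x.1

theorem pd_smooth {n : ℕ} {f : (Fin n → ℝ) → ℝ} (hf : ContDiff ℝ (⊤ : ℕ∞) f) (j : Fin n) :
    ContDiff ℝ (⊤ : ℕ∞) (pd f j) := by
  have h1 : ContDiff ℝ (⊤ : ℕ∞) (fderiv ℝ f) := hf.fderiv_right (by simp)
  exact h1.clm_apply contDiff_const

theorem pd_sum {n : ℕ} (f : (Fin n → ℝ) → ℝ) (q h : Fin n → ℝ) :
    fderiv ℝ f q h = ∑ j, pd f j q * h j := by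
  have : h = ∑ j, h j • (Pi.single j (1:ℝ) : Fin n → ℝ) := by
    ext i
    simp [Finset.sum_apply, Pi.single_apply]
  conv_lhs => rw [this]
  simp [pd, mul_comm]

theorem vf_smooth {n : ℕ} {B : Fin n → (Fin n → ℝ) → ℝ} {C : (Fin n → ℝ) → ℝ}
    (hB : ∀ i, ContDiff ℝ (⊤ : ℕ∞) (B i)) (hC : ContDiff ℝ (⊤ : ℕ∞) C) :
    ContDiff ℝ (⊤ : ℕ∞) (vf B C) := by
  unfold vf
  refine contDiff_snd.prodMk (contDiff_pi.2 fun i => ContDiff.sub (ContDiff.neg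
    (ContDiff.sum fun j _ => ContDiff.mul (ContDiff.sub ?_ ?_) ?_)) ?_)
  · exact (pd_smooth (hB i) j).comp contDiff_fst
  · exact (pd_smooth (hB j) i).comp contDiff_fst
  · exact (contDiff_apply ℝ ℝ j).comp contDiff_snd
  · exact (pd_smooth hC i).comp contDiff_fst

theorem Lag_smooth {n : ℕ} {B : Fin n → (Fin n → ℝ) → ℝ} {C : (Fin n → ℝ) → ℝ}
    (hB : ∀ i, ContDiff ℝ (⊤ : ℕ∞) (B i)) (hC : ContDiff ℝ (⊤ : ℕ∞) C) :
    ContDiff ℝ (⊤ : ℕ∞) (Lag B C) := by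
  unfold Lag
  refine ContDiff.sub (ContDiff.add (contDiff_const.mul (ContDiff.sum fun i _ => ContDiff.pow ?_ 2))
    (ContDiff.sum fun i _ => ContDiff.mul ?_ ?_)) (hC.comp contDiff_fst)
  · exact (contDiff_apply ℝ ℝ i).comp contDiff_snd
  · exact (hB i).comp contDiff_fst
  · exact (contDiff_apply ℝ ℝ i).comp contDiff_snd

theorem Lag_fderiv {n : ℕ} {B : Fin n → (Fin n → ℝ) → ℝ} {C : (Fin n → ℝ) → ℝ}
    (hB : ∀ i, ContDiff ℝ (⊤ : ℕ∞) (B i)) (hC : ContDiff ℝ (⊤ : ℕ∞) C)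
    (x h : (Fin n → ℝ) × (Fin n → ℝ)) :
    fderiv ℝ (Lag B C) x h = ∑ i, x.2 i * h.2 i
      + ∑ i, ((∑ j, pd (B i) j x.1 * h.1 j) * x.2 i + B i x.1 * h.2 i)
      - ∑ j, pd C j x.1 * h.1 j := by
  have hline : HasDerivAt (fun s : ℝ => x + s • h) h 0 := by
    simpa using ((hasDerivAt_id (0:ℝ)).smul_const h).const_add x
  have h1 := HasFDerivAt.comp_hasDerivAt (0:ℝ)
    (((Lag_smooth hB hC).differentiable (by simp)) (x + (0:ℝ) • h)).hasFDerivAt hline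
  have hl1 : HasDerivAt (fun s : ℝ => x.1 + s • h.1) h.1 0 := by
    simpa using ((hasDerivAt_id (0:ℝ)).smul_const h.1).const_add x.1
  have hl2 : ∀ i, HasDerivAt (fun s : ℝ => x.2 i + s * h.2 i) (h.2 i) 0 := fun i => by
    simpa using ((hasDerivAt_id (0:ℝ)).mul_const (h.2 i)).const_add (x.2 i)
  have hBd : ∀ i, HasDerivAt (fun s : ℝ => B i (x.1 + s • h.1)) (fderiv ℝ (B i) x.1 h.1) 0 :=
    fun i => by
      have := HasFDerivAt.comp_hasDerivAt (0:ℝ)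
        (((hB i).differentiable (by simp)) (x.1 + (0:ℝ) • h.1)).hasFDerivAt hl1
      exact this.congr_deriv (by simp)
  have hCd : HasDerivAt (fun s : ℝ => C (x.1 + s • h.1)) (fderiv ℝ C x.1 h.1) 0 := by
      have := HasFDerivAt.comp_hasDerivAt (0:ℝ)
        ((hC.differentiable (by simp)) (x.1 + (0:ℝ) • h.1)).hasFDerivAt hl1
      exact this.congr_deriv (by simp)
  have h2 : HasDerivAt (fun s : ℝ => (1:ℝ)/2 * ∑ i, (x.2 i + s * h.2 i) ^ 2
      + ∑ i, B i (x.1 + s • h.1) * (x.2 i + s * h.2 i) - C (x.1 + s • h.1))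
      ((1:ℝ)/2 * ∑ i, (2 * (x.2 i + 0 * h.2 i) * h.2 i)
      + ∑ i, (fderiv ℝ (B i) x.1 h.1 * (x.2 i + 0 * h.2 i)
        + B i (x.1 + (0:ℝ) • h.1) * h.2 i) - fderiv ℝ C x.1 h.1) 0 := by
    refine HasDerivAt.sub (HasDerivAt.add (HasDerivAt.const_mul _
      (HasDerivAt.fun_sum fun i _ => ?_)) (HasDerivAt.fun_sum fun i _ => (hBd i).mul (hl2 i))) hCd
    exact ((hl2 i).pow 2).congr_deriv (by simp)
  have h3 : (Lag B C ∘ fun s : ℝ => x + s • h) = (fun s : ℝ => (1:ℝ)/2 * ∑ i, (x.2 i + s * h.2 i) ^ 2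
      + ∑ i, B i (x.1 + s • h.1) * (x.2 i + s * h.2 i) - C (x.1 + s • h.1)) := by
    ext s; simp [Lag]
  rw [h3] at h1
  have h4 := h1.unique h2
  simp only [zero_smul, add_zero, zero_mul] at h4
  rw [h4, ← pd_sum C]
  congr 2
  · rw [Finset.mul_sum]
    exact Finset.sum_congr rfl fun i _ => by ring
  · exact Finset.sum_congr rfl fun i _ => by rw [pd_sum]

theorem EL_identity {n : ℕ} {B : Fin n → (Fin n → ℝ) → ℝ} {C : (Fin n → ℝ) → ℝ}
    (hB : ∀ i, ContDiff ℝ (⊤ : ℕ∞) (B i)) (hC : ContDiff ℝ (⊤ : ℕ∞) C)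
    {y y' : ℝ → (Fin n → ℝ) × (Fin n → ℝ)} {τ : ℝ}
    (hy : HasDerivAt y (vf B C (y τ)) τ) (hy' : HasDerivAt y' (vf B C (y' τ)) τ) :
    HasDerivAt (fun s => ∑ i, ((y s).2 i + B i (y s).1) * ((y' s).1 i - (y s).1 i))
      (fderiv ℝ (Lag B C) (y τ) (y' τ - y τ)) τ := by
  have h1 : HasDerivAt (fun s => (y s).1) (y τ).2 τ := hy.fst
  have h1' : HasDerivAt (fun s => (y' s).1) (y' τ).2 τ := hy'.fst
  have h2 : HasDerivAt (fun s => (y s).2) (vf B C (y τ)).2 τ := hy.snd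
  have h3 : ∀ i, HasDerivAt (fun s => B i (y s).1) (fderiv ℝ (B i) (y τ).1 (y τ).2) τ :=
    fun i => HasFDerivAt.comp_hasDerivAt τ
      (((hB i).differentiable (by simp)) (y τ).1).hasFDerivAt h1
  have h4 := HasDerivAt.fun_sum (u := Finset.univ) fun i _ =>
    ((hasDerivAt_pi.1 h2 i).add (h3 i)).mul ((hasDerivAt_pi.1 h1' i).sub (hasDerivAt_pi.1 h1 i))
  refine h4.congr_deriv ?_
  rw [Lag_fderiv hB hC]
  simp only [pd_sum (B _), Prod.fst_sub, Prod.snd_sub, Pi.sub_apply, Pi.add_apply]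
  simp only [vf]
  generalize (y τ).2 = v
  generalize (y' τ).2 = v'
  generalize (y τ).1 = q
  generalize (y' τ).1 = q'
  have e1 : ∀ i, -(∑ j, (pd (B i) j q - pd (B j) i q) * v j) - pd C i q + ∑ j, pd (B i) j q * v j
      = ∑ j, pd (B j) i q * v j - pd C i q := fun i => by
    simp only [sub_mul, Finset.sum_sub_distrib]; ring
  simp only [e1]
  have e2 : ∑ i, (∑ j, pd (B i) j q * (q' j - q j)) * v i
      = ∑ i, (∑ j, pd (B j) i q * v j) * (q' i - q i) := by
    simp only [Finset.sum_mul]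
    rw [Finset.sum_comm]
    exact Finset.sum_congr rfl fun i _ => Finset.sum_congr rfl fun j _ => by ring
  rw [Finset.sum_add_distrib (f := fun i => (∑ j, pd (B i) j q * (q' j - q j)) * v i), e2,
    ← Finset.sum_add_distrib, ← Finset.sum_add_distrib, ← Finset.sum_sub_distrib]
  exact Finset.sum_congr rfl fun i _ => by ring

theorem path_ode {n : ℕ} {B : Fin n → (Fin n → ℝ) → ℝ} {C : (Fin n → ℝ) → ℝ}
    {t : ℝ} {γ : ℝ → Fin n → ℝ} (hγ : ContDiff ℝ (⊤ : ℕ∞) γ) (hc : IsClassical B C t γ) :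
    ∀ τ ∈ Icc (0:ℝ) t, HasDerivAt (fun s => (γ s, deriv γ s)) (vf B C (γ τ, deriv γ τ)) τ := by
  intro τ hτ
  have h1 : HasDerivAt γ (deriv γ τ) τ := (hγ.differentiable (by simp) τ).hasDerivAt
  have h2 : ContDiff ℝ 1 (deriv γ) := by
    have : ContDiff ℝ (1 + 1) γ := contDiff_infty.1 hγ 2
    exact ((contDiff_succ_iff_deriv (n := 1)).1 this).2.2
  have h3 : HasDerivAt (deriv γ) (deriv (deriv γ) τ) τ :=
    (h2.differentiable (by simp) τ).hasDerivAt
  refine (h1.prodMk h3).congr_deriv ?_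
  refine Prod.ext rfl ?_
  ext i
  have := hc τ hτ i
  simp only [vf]
  linarith

theorem first_var {n : ℕ} {B : Fin n → (Fin n → ℝ) → ℝ} {C : (Fin n → ℝ) → ℝ}
    (hB : ∀ i, ContDiff ℝ (⊤ : ℕ∞) (B i)) (hC : ContDiff ℝ (⊤ : ℕ∞) C) {t R A : ℝ} (ht : 0 < t)
    {Y : (Fin n → ℝ) → ℝ → (Fin n → ℝ) × (Fin n → ℝ)} {q1 : Fin n → ℝ}
    (hode : ∀ᶠ q' in 𝓝 q1, ∀ τ ∈ Icc (0:ℝ) t, HasDerivAt (Y q') (vf B C (Y q' τ)) τ)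
    (hR : ∀ᶠ q' in 𝓝 q1, ∀ τ ∈ Icc (0:ℝ) t, ‖Y q' τ‖ ≤ R)
    (hA : ∀ᶠ q' in 𝓝 q1, ∀ τ ∈ Icc (0:ℝ) t, ‖Y q' τ - Y q1 τ‖ ≤ A * ‖q' - q1‖)
    (h0 : ∀ᶠ q' in 𝓝 q1, (Y q' 0).1 = (Y q1 0).1)
    (h1 : ∀ᶠ q' in 𝓝 q1, (Y q' t).1 = q') :
    HasFDerivAt (fun q' => ∫ τ in (0:ℝ)..t, Lag B C (Y q' τ))
      (∑ i, ((Y q1 t).2 i + B i q1) • (ContinuousLinearMap.proj i : (Fin n → ℝ) →L[ℝ] ℝ)) q1 := by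
  have hL := Lag_smooth hB hC
  obtain ⟨M2, hM20, hM2⟩ := quad_ball hL R
  have hcont : ∀ q', (∀ τ ∈ Icc (0:ℝ) t, HasDerivAt (Y q') (vf B C (Y q' τ)) τ) →
      ContinuousOn (Y q') (Icc 0 t) := fun q' h τ hτ => (h τ hτ).continuousAt.continuousWithinAt
  have b1 := hode.self_of_nhds
  have bR := hR.self_of_nhds
  have bt := h1.self_of_nhds
  refine hasFDerivAt_of_quad (M := M2 * A ^ 2 * t) ?_
  filter_upwards [hode, hR, hA, h0, h1] with q' c1 cR cA c0 ct
  have i1 : IntervalIntegrable (fun τ => Lag B C (Y q' τ)) volume 0 t := by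
    refine ContinuousOn.intervalIntegrable ?_
    rw [uIcc_of_le ht.le]
    exact hL.continuous.comp_continuousOn (hcont _ c1)
  have i2 : IntervalIntegrable (fun τ => Lag B C (Y q1 τ)) volume 0 t := by
    refine ContinuousOn.intervalIntegrable ?_
    rw [uIcc_of_le ht.le]
    exact hL.continuous.comp_continuousOn (hcont _ b1)
  have i3 : IntervalIntegrable (fun τ => fderiv ℝ (Lag B C) (Y q1 τ) (Y q' τ - Y q1 τ))
      volume 0 t := by
    refine ContinuousOn.intervalIntegrable ?_
    rw [uIcc_of_le ht.le]
    exact ((hL.continuous_fderiv (by simp)).comp_continuousOn (hcont _ b1)).clm_apply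
      ((hcont _ c1).sub (hcont _ b1))
  have e1 := intervalIntegral.integral_eq_sub_of_hasDerivAt (a := 0) (b := t)
    (f := fun s => ∑ i, ((Y q1 s).2 i + B i (Y q1 s).1) * ((Y q' s).1 i - (Y q1 s).1 i))
    (f' := fun τ => fderiv ℝ (Lag B C) (Y q1 τ) (Y q' τ - Y q1 τ))
    (fun τ hτ => by
      rw [uIcc_of_le ht.le] at hτ
      exact EL_identity hB hC (b1 τ hτ) (c1 τ hτ)) i3
  have e2 : (∑ i, ((Y q1 t).2 i + B i q1) • (ContinuousLinearMap.proj i : (Fin n → ℝ) →L[ℝ] ℝ))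
      (q' - q1) = ∫ τ in (0:ℝ)..t, fderiv ℝ (Lag B C) (Y q1 τ) (Y q' τ - Y q1 τ) := by
    rw [e1]
    simp [c0, ct, bt]
  rw [e2, ← intervalIntegral.integral_sub i1 i2, ← intervalIntegral.integral_sub (i1.sub i2) i3]
  have := intervalIntegral.norm_integral_le_of_norm_le_const (a := 0) (b := t)
    (C := M2 * (A * ‖q' - q1‖) ^ 2)
    (f := fun τ => Lag B C (Y q' τ) - Lag B C (Y q1 τ)
      - fderiv ℝ (Lag B C) (Y q1 τ) (Y q' τ - Y q1 τ)) (fun τ hτ => by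
      rw [uIoc_of_le ht.le] at hτ
      have hτ' := Ioc_subset_Icc_self hτ
      refine (hM2 _ _ (bR τ hτ') (cR τ hτ')).trans ?_
      gcongr
      exact cA τ hτ')
  refine this.trans (le_of_eq ?_)
  rw [sub_zero, abs_of_pos ht]
  ring

/-- The phase space path of a member of a smooth family. -/
def YY {n : ℕ} {B : Fin n → (Fin n → ℝ) → ℝ} {C : (Fin n → ℝ) → ℝ}
    {O : Set (ℝ × (Fin n → ℝ) × (Fin n → ℝ))} (F : SmoothFamily B C O) (t : ℝ)
    (r : (Fin n → ℝ) × (Fin n → ℝ)) (τ : ℝ) : (Fin n → ℝ) × (Fin n → ℝ) :=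
  (F.f τ t r.1 r.2, deriv (fun s => F.f s t r.1 r.2) τ)

theorem YY_ode {n : ℕ} {B : Fin n → (Fin n → ℝ) → ℝ} {C : (Fin n → ℝ) → ℝ}
    {O : Set (ℝ × (Fin n → ℝ) × (Fin n → ℝ))} (F : SmoothFamily B C O) {t : ℝ}
    {r : (Fin n → ℝ) × (Fin n → ℝ)} (hr : (t, r) ∈ O) :
    ∀ τ ∈ Icc (0:ℝ) t, HasDerivAt (YY F t r) (vf B C (YY F t r τ)) τ :=
  path_ode (F.pathSmooth _ hr) (F.isClassical _ hr)

theorem mid_smooth {n : ℕ} {B : Fin n → (Fin n → ℝ) → ℝ} {C : (Fin n → ℝ) → ℝ}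
    {O : Set (ℝ × (Fin n → ℝ) × (Fin n → ℝ))} (F : SmoothFamily B C O) {t : ℝ}
    {r : (Fin n → ℝ) × (Fin n → ℝ)} (hr : (t, r) ∈ O) :
    ContDiffAt ℝ 1 (fun r => YY F t r (t / 2)) r := by
  have ht : 0 < t := F.pos _ hr
  set P : ℝ × ℝ × (Fin n → ℝ) × (Fin n → ℝ) → (Fin n → ℝ) :=
    fun p => F.f p.1 p.2.1 p.2.2.1 p.2.2.2 with hP
  have hev : ∀ r' : (Fin n → ℝ) × (Fin n → ℝ), (t, r') ∈ O →
      ContDiffAt ℝ (⊤ : ℕ∞) P (t / 2, t, r') := by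
    intro r' hr'
    refine F.smooth.contDiffAt ?_
    have h1 : ∀ᶠ p : ℝ × ℝ × (Fin n → ℝ) × (Fin n → ℝ) in 𝓝 (t / 2, t, r'), p.2 ∈ O :=
      continuous_snd.continuousAt.eventually (F.isOpen.mem_nhds hr')
    have h2 : ∀ᶠ p : ℝ × ℝ × (Fin n → ℝ) × (Fin n → ℝ) in 𝓝 (t / 2, t, r'), 0 < p.1 :=
      continuous_fst.continuousAt.eventually (lt_mem_nhds (by simpa using ht))
    have h3 : ∀ᶠ p : ℝ × ℝ × (Fin n → ℝ) × (Fin n → ℝ) in 𝓝 (t / 2, t, r'), 0 < p.2.1 - p.1 := by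
      have hc : Continuous fun p : ℝ × ℝ × (Fin n → ℝ) × (Fin n → ℝ) => p.2.1 - p.1 := by fun_prop
      exact hc.continuousAt.eventually (lt_mem_nhds (by simp; linarith))
    filter_upwards [h1, h2, h3] with p a b c
    exact ⟨a, b.le, by linarith⟩
  have hO : ∀ᶠ r' in 𝓝 r, (t, r') ∈ O :=
    (Continuous.prodMk_right t).continuousAt.eventually (F.isOpen.mem_nhds hr)
  have hι : ContDiff ℝ (⊤ : ℕ∞) (fun r' : (Fin n → ℝ) × (Fin n → ℝ) => (t / 2, t, r')) :=
    contDiff_const.prodMk (contDiff_const.prodMk contDiff_id)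
  have hP1 : ContDiffAt ℝ 1 (fun r' => P (t / 2, t, r')) r :=
    (((hev r hr).of_le (by simp)).comp r (hι.of_le (by simp)).contDiffAt)
  have hfd : ContDiffAt ℝ 1 (fderiv ℝ P) (t / 2, t, r) :=
    (contDiffAt_infty.1 (hev r hr) 2).fderiv_right (m := 1) one_add_one_eq_two.le
  have hP2 : ContDiffAt ℝ 1 (fun r' => fderiv ℝ P (t / 2, t, r') (1, 0)) r :=
    (hfd.comp r (hι.of_le (by simp)).contDiffAt).clm_apply contDiffAt_const
  refine hP1.prodMk (hP2.congr_of_eventuallyEq ?_)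
  filter_upwards [hO] with r' hr'
  have hd := ((hev r' hr').differentiableAt (by simp)).hasFDerivAt
  have hl : HasDerivAt (fun s : ℝ => (s, t, r')) (1, 0) (t / 2) :=
    (hasDerivAt_id _).prodMk (hasDerivAt_const _ _)
  exact (HasFDerivAt.comp_hasDerivAt (t / 2) hd hl).deriv

theorem near_flow {n : ℕ} {B : Fin n → (Fin n → ℝ) → ℝ} {C : (Fin n → ℝ) → ℝ}
    (hB : ∀ i, ContDiff ℝ (⊤ : ℕ∞) (B i)) (hC : ContDiff ℝ (⊤ : ℕ∞) C)
    {W : Set ((Fin n → ℝ) × (Fin n → ℝ))} (hW : IsOpen W) {ε M : ℝ}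
    {Φ : (Fin n → ℝ) × (Fin n → ℝ) → ℝ → (Fin n → ℝ) × (Fin n → ℝ)}
    (hΦ : FlowOn (vf B C) W ε M Φ)
    {O : Set (ℝ × (Fin n → ℝ) × (Fin n → ℝ))} (F : SmoothFamily B C O) {t : ℝ} (ht : t < ε)
    {r : (Fin n → ℝ) × (Fin n → ℝ)} (hr : (t, r) ∈ O) (hz : YY F t r (t / 2) ∈ W) :
    ∀ᶠ r' in 𝓝 r, (t, r') ∈ O ∧ YY F t r' (t / 2) ∈ W ∧
      ∀ τ ∈ Icc (0:ℝ) t, YY F t r' τ = Φ (YY F t r' (t / 2)) (τ - t / 2) := by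
  have ht0 : 0 < t := F.pos _ hr
  have hO : ∀ᶠ r' in 𝓝 r, (t, r') ∈ O :=
    (Continuous.prodMk_right t).continuousAt.eventually (F.isOpen.mem_nhds hr)
  have hZ : ∀ᶠ r' in 𝓝 r, YY F t r' (t / 2) ∈ W :=
    (mid_smooth F hr).continuousAt.eventually (hW.mem_nhds hz)
  filter_upwards [hO, hZ] with r' a b
  exact ⟨a, b, FlowOn.eq_of_solution (vf_smooth hB hC) hΦ ht (YY_ode F a)
    ⟨by linarith, by linarith⟩ b⟩

theorem famS_fderiv {n : ℕ} {B : Fin n → (Fin n → ℝ) → ℝ} {C : (Fin n → ℝ) → ℝ}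
    (hB : ∀ i, ContDiff ℝ (⊤ : ℕ∞) (B i)) (hC : ContDiff ℝ (⊤ : ℕ∞) C)
    {W : Set ((Fin n → ℝ) × (Fin n → ℝ))} (hW : IsOpen W) {ε M : ℝ}
    {Φ : (Fin n → ℝ) × (Fin n → ℝ) → ℝ → (Fin n → ℝ) × (Fin n → ℝ)}
    (hΦ : FlowOn (vf B C) W ε M Φ)
    {O : Set (ℝ × (Fin n → ℝ) × (Fin n → ℝ))} (F : SmoothFamily B C O) {t : ℝ} (ht : t < ε)
    {q q1 : Fin n → ℝ} (hr : (t, q, q1) ∈ O) (hz : YY F t (q, q1) (t / 2) ∈ W) :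
    HasFDerivAt (fun q1' => famS F t q q1')
      (∑ i, ((YY F t (q, q1) t).2 i + B i q1) •
        (ContinuousLinearMap.proj i : (Fin n → ℝ) →L[ℝ] ℝ)) q1 := by
  have ht0 : 0 < t := F.pos _ hr
  have hn0 := near_flow hB hC hW hΦ F ht hr hz
  have hcont : Continuous (fun q1' : Fin n → ℝ => (q, q1')) := by fun_prop
  have hn1 : ∀ᶠ q1' in 𝓝 q1, (t, q, q1') ∈ O ∧ YY F t (q, q1') (t / 2) ∈ W ∧
      ∀ τ ∈ Icc (0:ℝ) t, YY F t (q, q1') τ = Φ (YY F t (q, q1') (t / 2)) (τ - t / 2) :=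
    hcont.continuousAt.eventually hn0
  obtain ⟨L, s, hs, hL⟩ := (mid_smooth F hr).exists_lipschitzOnWith
  have hn2 : ∀ᶠ q1' in 𝓝 q1, (q, q1') ∈ s := hcont.continuousAt.eventually hs
  obtain ⟨Λ, hΛ0, hΛ⟩ := FlowOn.lip (vf_smooth hB hC) hΦ
  have hτ : ∀ τ ∈ Icc (0:ℝ) t, τ - t / 2 ∈ Ioo (-ε) ε := fun τ hτ =>
    ⟨by linarith [hτ.1], by linarith [hτ.2]⟩
  have hb := hn1.self_of_nhds
  have hb2 := hn2.self_of_nhds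
  have := first_var hB hC (t := t) (R := M) (A := Λ * L) ht0
    (Y := fun q1' => YY F t (q, q1')) (q1 := q1) ?_ ?_ ?_ ?_ ?_
  · refine this.congr_of_eventuallyEq ?_
    exact Eventually.of_forall fun q1' => rfl
  · filter_upwards [hn1] with q' h
    exact YY_ode F h.1
  · filter_upwards [hn1] with q' h τ hτ'
    rw [h.2.2 τ hτ']
    exact hΦ.bdd _ h.2.1 _ (hτ τ hτ')
  · filter_upwards [hn1, hn2] with q' h h' τ hτ'
    rw [h.2.2 τ hτ', hb.2.2 τ hτ', mul_assoc]
    refine (hΛ _ h.2.1 _ hb.2.1 _ (hτ τ hτ')).trans ?_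
    gcongr
    have h4 := hL.dist_le_mul _ h' _ hb2
    rw [dist_eq_norm, dist_eq_norm] at h4
    simpa using h4
  · filter_upwards [hn1] with q' h
    exact (F.bdry0 _ h.1).trans (F.bdry0 _ hr).symm
  · filter_upwards [hn1] with q' h
    exact F.bdry1 _ h.1

theorem back_bound {n : ℕ} {B : Fin n → (Fin n → ℝ) → ℝ} {C : (Fin n → ℝ) → ℝ}
    (hB : ∀ i, ContDiff ℝ (⊤ : ℕ∞) (B i)) (hC : ContDiff ℝ (⊤ : ℕ∞) C)
    {W : Set ((Fin n → ℝ) × (Fin n → ℝ))} (hW : IsOpen W) {ε M : ℝ}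
    {Φ : (Fin n → ℝ) × (Fin n → ℝ) → ℝ → (Fin n → ℝ) × (Fin n → ℝ)}
    (hΦ : FlowOn (vf B C) W ε M Φ) :
    ∃ c : ℝ, 0 ≤ c ∧ ∀ q1 v1 : Fin n → ℝ, (q1, v1) ∈ W → ∀ t : ℝ, 0 < t → t < ε →
      ∀ D : (Fin n → ℝ) →L[ℝ] (Fin n → ℝ),
        HasFDerivAt (fun v => (Φ (q1, v) (-t)).1) D v1 → ∀ h, ‖D h + t • h‖ ≤ c * t ^ 2 * ‖h‖ := by
  have hf := vf_smooth hB hC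
  obtain ⟨L, hL⟩ := lip_ball hf M
  obtain ⟨Λ, hΛ0, hΛ⟩ := FlowOn.lip hf hΦ
  refine ⟨L * Λ, by positivity, fun q1 v1 hw t ht0 ht D hD h => ?_⟩
  have hD' : HasFDerivAt (fun v => (Φ (q1, v) (-t)).1 + t • v)
      (D + t • ContinuousLinearMap.id ℝ (Fin n → ℝ)) v1 :=
    hD.add ((hasFDerivAt_id v1).const_smul t)
  have hcont : Continuous (fun v : Fin n → ℝ => (q1, v)) := by fun_prop
  have hn : ∀ᶠ v in 𝓝 v1, (q1, v) ∈ W := hcont.continuousAt.eventually (hW.mem_nhds hw)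
  have hmem : -t ∈ Ioo (-ε) ε := ⟨by linarith, by linarith⟩
  have hlip : ∀ᶠ v in 𝓝 v1, ‖((Φ (q1, v) (-t)).1 + t • v) - ((Φ (q1, v1) (-t)).1 + t • v1)‖
      ≤ (L * Λ * t ^ 2) * ‖v - v1‖ := by
    filter_upwards [hn] with v hv
    have o1 := hΦ.ode _ hv
    have o2 := hΦ.ode _ hw
    have i1 := hΦ.atzero _ hv
    have i2 := hΦ.atzero _ hw
    have := taylor2 (δ := ε) (t := -t) (M := L * Λ * ‖v - v1‖)
      (g := fun s => (Φ (q1, v) s).1 - (Φ (q1, v1) s).1 - s • (v - v1))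
      (g' := fun s => (Φ (q1, v) s).2 - (Φ (q1, v1) s).2 - (v - v1))
      (g'' := fun s => (vf B C (Φ (q1, v) s)).2 - (vf B C (Φ (q1, v1) s)).2)
      (by simp [i1, i2]) (by simp [i1, i2])
      (fun s hs => by
        have a1 : HasDerivAt (fun s => (Φ (q1, v) s).1) (Φ (q1, v) s).2 s := (o1 s hs).fst
        have a2 : HasDerivAt (fun s => (Φ (q1, v1) s).1) (Φ (q1, v1) s).2 s := (o2 s hs).fst
        have a3 : HasDerivAt (fun s : ℝ => s • (v - v1)) (v - v1) s := by
          simpa using (hasDerivAt_id s).smul_const (v - v1)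
        exact (a1.sub a2).sub a3)
      (fun s hs => by
        have a1 : HasDerivAt (fun s => (Φ (q1, v) s).2) (vf B C (Φ (q1, v) s)).2 s := (o1 s hs).snd
        have a2 : HasDerivAt (fun s => (Φ (q1, v1) s).2) (vf B C (Φ (q1, v1) s)).2 s :=
          (o2 s hs).snd
        exact (a1.sub a2).sub_const _)
      (fun s hs => by
        have b1 := hL.dist_le_mul (Φ (q1, v) s) (by simpa using hΦ.bdd _ hv s hs)
          (Φ (q1, v1) s) (by simpa using hΦ.bdd _ hw s hs)
        rw [dist_eq_norm, dist_eq_norm] at b1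
        have b2 := hΛ _ hv _ hw s hs
        have b3 : ‖((q1, v) : (Fin n → ℝ) × (Fin n → ℝ)) - (q1, v1)‖ = ‖v - v1‖ := by
          simp [Prod.norm_def]
        rw [b3] at b2
        refine (norm_snd_le (vf B C (Φ (q1, v) s) - vf B C (Φ (q1, v1) s))).trans (b1.trans ?_)
        rw [mul_assoc]
        gcongr)
      hmem
    have e : ((Φ (q1, v) (-t)).1 + t • v) - ((Φ (q1, v1) (-t)).1 + t • v1)
        = (Φ (q1, v) (-t)).1 - (Φ (q1, v1) (-t)).1 - (-t) • (v - v1) := by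
      rw [neg_smul, smul_sub]; abel
    rw [e]
    refine this.trans (le_of_eq (by ring))
  have h5 := hD'.le_of_lip' (by positivity) hlip
  have h6 := (D + t • ContinuousLinearMap.id ℝ (Fin n → ℝ)).le_of_opNorm_le h5 h
  simpa using h6

theorem hess_bound {n : ℕ} {B : Fin n → (Fin n → ℝ) → ℝ} {C : (Fin n → ℝ) → ℝ}
    (hB : ∀ i, ContDiff ℝ (⊤ : ℕ∞) (B i)) (hC : ContDiff ℝ (⊤ : ℕ∞) C)
    {W : Set ((Fin n → ℝ) × (Fin n → ℝ))} (hW : IsOpen W) {ε M : ℝ}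
    {Φ : (Fin n → ℝ) × (Fin n → ℝ) → ℝ → (Fin n → ℝ) × (Fin n → ℝ)}
    (hΦ : FlowOn (vf B C) W ε M Φ) :
    ∃ c : ℝ, 0 ≤ c ∧ ∀ t : ℝ, t < ε → ∀ (q q1 : Fin n → ℝ)
      (O : Set (ℝ × (Fin n → ℝ) × (Fin n → ℝ))) (F : SmoothFamily B C O),
      (t, q, q1) ∈ O → YY F t (q, q1) (t / 2) ∈ W → YY F t (q, q1) t ∈ W →
      ∀ k l : Fin n, |(Hess01 (fun a b c' => -(famS F a b c')) t q q1)⁻¹ k l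
                    - t * (if k = l then 1 else 0)| ≤ c * t ^ 2 := by
  have hf := vf_smooth hB hC
  obtain ⟨c, hc0, hc⟩ := back_bound hB hC hW hΦ
  refine ⟨c, hc0, fun t ht q q1 O F hr hz hw k l => ?_⟩
  have ht0 : 0 < t := F.pos _ hr
  have hn0 := near_flow hB hC hW hΦ F ht hr hz
  have hcont : Continuous (fun q' : Fin n → ℝ => (q', q1)) := by fun_prop
  have hn1 : ∀ᶠ q' in 𝓝 q, (t, q', q1) ∈ O ∧ YY F t (q', q1) (t / 2) ∈ W ∧
      ∀ τ ∈ Icc (0:ℝ) t, YY F t (q', q1) τ = Φ (YY F t (q', q1) (t / 2)) (τ - t / 2) :=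
    hcont.continuousAt.eventually hn0
  set v1 : (Fin n → ℝ) → (Fin n → ℝ) := fun q' => (YY F t (q', q1) t).2 with hv1
  have hYt : ∀ q', (t, q', q1) ∈ O → YY F t (q', q1) t = (q1, v1 q') := fun q' h =>
    Prod.ext (F.bdry1 _ h) rfl
  have hY0 : ∀ q', (t, q', q1) ∈ O → (YY F t (q', q1) 0).1 = q' := fun q' h => F.bdry0 _ h
  -- differentiability of the final velocity
  have hv1d : DifferentiableAt ℝ v1 q := by
    have hmid : DifferentiableAt ℝ (fun q' => YY F t (q', q1) (t / 2)) q := by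
      have h1 := (mid_smooth F hr).differentiableAt (by simp)
      have h2 : DifferentiableAt ℝ (fun q' : Fin n → ℝ => (q', q1)) q := by fun_prop
      exact DifferentiableAt.comp (f := fun q' : Fin n → ℝ => (q', q1)) q h1 h2
    have hΦd : DifferentiableAt ℝ (fun p : ((Fin n → ℝ) × (Fin n → ℝ)) × ℝ => Φ p.1 p.2)
        (YY F t (q, q1) (t / 2), t - t / 2) := by
      refine (hΦ.smooth.contDiffAt ?_).differentiableAt (by simp)
      exact (hW.prod isOpen_Ioo).mem_nhds ⟨hz, by constructor <;> simp <;> linarith⟩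
    have h3 : DifferentiableAt ℝ (fun q' => Φ (YY F t (q', q1) (t / 2)) (t - t / 2)) q :=
      DifferentiableAt.comp (f := fun q' => (YY F t (q', q1) (t / 2), t - t / 2)) q hΦd
        (hmid.prodMk (differentiableAt_const _))
    refine (h3.snd).congr_of_eventuallyEq ?_
    filter_upwards [hn1] with q' h
    change (YY F t (q', q1) t).2 = _
    rw [h.2.2 t ⟨ht0.le, le_rfl⟩]
  -- the inverse map
  have hwq : (q1, v1 q) ∈ W := by rw [← hYt q hr]; exact hw
  have hbd : DifferentiableAt ℝ (fun v => (Φ (q1, v) (-t)).1) (v1 q) := by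
    have hΦd : DifferentiableAt ℝ (fun p : ((Fin n → ℝ) × (Fin n → ℝ)) × ℝ => Φ p.1 p.2)
        ((q1, v1 q), -t) := by
      refine (hΦ.smooth.contDiffAt ?_).differentiableAt (by simp)
      exact (hW.prod isOpen_Ioo).mem_nhds ⟨hwq, by constructor <;> simp <;> linarith⟩
    have h2 : DifferentiableAt ℝ (fun v : Fin n → ℝ => ((q1, v), -t)) (v1 q) := by fun_prop
    exact (DifferentiableAt.comp (f := fun v : Fin n → ℝ => ((q1, v), -t)) (v1 q) hΦd h2).fst
  have hback : ∀ᶠ q' in 𝓝 q, (Φ (q1, v1 q') (-t)).1 = q' := by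
    have h1 : ∀ᶠ q' in 𝓝 q, (q1, v1 q') ∈ W :=
      (continuousAt_const.prodMk hv1d.continuousAt).eventually (hW.mem_nhds hwq)
    filter_upwards [hn1, h1] with q' h h'
    have h2 := FlowOn.eq_of_solution hf hΦ ht (YY_ode F h.1) (s := t) ⟨ht0.le, le_rfl⟩
      (by rw [hYt q' h.1]; exact h') 0 ⟨le_rfl, ht0.le⟩
    rw [hYt q' h.1, zero_sub] at h2
    rw [← h2]
    exact hY0 q' h.1
  set D := fderiv ℝ (fun v => (Φ (q1, v) (-t)).1) (v1 q) with hD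
  set V := fderiv ℝ v1 q with hV
  have hcomp : ∀ h, D (V h) = h := by
    have h1 := HasFDerivAt.comp q hbd.hasFDerivAt hv1d.hasFDerivAt
    have h2 : HasFDerivAt (fun q' : Fin n → ℝ => q') (D.comp V) q :=
      h1.congr_of_eventuallyEq (by
        filter_upwards [hback] with q' h
        exact h.symm)
    have h3 := h2.unique (hasFDerivAt_id q)
    intro h
    exact congrArg (fun A : (Fin n → ℝ) →L[ℝ] (Fin n → ℝ) => A h) h3
  have hHess : ∀ a b, Hess01 (fun a b c' => -(famS F a b c')) t q q1 a b
      = -(V (Pi.single a 1) b) := by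
    intro a b
    change fderiv ℝ (fun q0' => fderiv ℝ (fun q1' => -(famS F t q0' q1')) q1 (Pi.single b 1)) q
      (Pi.single a 1) = _
    have h1 : (fun q0' => fderiv ℝ (fun q1' => -(famS F t q0' q1')) q1 (Pi.single b 1))
        =ᶠ[𝓝 q] fun q0' => -(v1 q0' b + B b q1) := by
      filter_upwards [hn1] with q' h
      have h2 := (famS_fderiv hB hC hW hΦ F ht h.1 h.2.1).neg
      have h3 : fderiv ℝ (fun q1' => -(famS F t q' q1')) q1 = _ := h2.fderiv
      rw [h3]
      simp [hv1, Pi.single_apply]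
    rw [h1.fderiv_eq]
    have h4 : HasFDerivAt (fun q0' => -(v1 q0' b + B b q1))
        (-((ContinuousLinearMap.proj b : (Fin n → ℝ) →L[ℝ] ℝ).comp V)) q :=
      ((hasFDerivAt_pi'.1 hv1d.hasFDerivAt b).add_const _).neg
    rw [h4.fderiv]
    simp
  have hsum : ∀ w : Fin n → ℝ, D w = ∑ j, w j • D (Pi.single j 1) := by
    intro w
    have : w = ∑ j, w j • (Pi.single j (1:ℝ) : Fin n → ℝ) := by
      ext i
      simp [Finset.sum_apply, Pi.single_apply]
    conv_lhs => rw [this]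
    simp
  have hinv : (Hess01 (fun a b c' => -(famS F a b c')) t q q1)⁻¹
      = Matrix.of fun a b => -(D (Pi.single a 1) b) := by
    refine Matrix.inv_eq_right_inv ?_
    ext a b
    rw [Matrix.mul_apply, Matrix.one_apply]
    simp only [hHess, Matrix.of_apply, neg_mul_neg]
    have h1 := congrFun (hcomp (Pi.single a 1)) b
    rw [hsum] at h1
    simp only [Finset.sum_apply, Pi.smul_apply, smul_eq_mul] at h1
    rw [h1, Pi.single_apply]
    simp [eq_comm]
  rw [hinv, Matrix.of_apply]
  have h7 := hc q1 (v1 q) hwq t ht0 ht D hbd.hasFDerivAt (Pi.single k 1)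
  have h8 := (norm_le_pi_norm (D (Pi.single k 1) + t • (Pi.single k (1:ℝ) : Fin n → ℝ)) l).trans h7
  have h9 : ‖(Pi.single k (1:ℝ) : Fin n → ℝ)‖ ≤ 1 := by
    refine (pi_norm_le_iff_of_nonneg zero_le_one).2 fun i => ?_
    rw [Pi.single_apply]
    split_ifs <;> simp
  have h10 : -(D (Pi.single k 1) l) - t * (if k = l then 1 else 0)
      = -((D (Pi.single k 1) + t • (Pi.single k (1:ℝ) : Fin n → ℝ)) l) := by
    simp only [Pi.add_apply, Pi.smul_apply, Pi.single_apply, smul_eq_mul, eq_comm (a := k)]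
    ring
  rw [h10, abs_neg, ← Real.norm_eq_abs]
  refine h8.trans ?_
  nlinarith [mul_nonneg hc0 (sq_nonneg t)]

theorem FlowOn.near_start {E : Type} [NormedAddCommGroup E] [NormedSpace ℝ E] {f : E → E}
    {W : Set E} {ε M : ℝ} {Φ : E → ℝ → E} (hΦ : FlowOn f W ε M Φ) {Mf : ℝ}
    (hMf : ∀ x, ‖x‖ ≤ M → ‖f x‖ ≤ Mf) {x : E} (hx : x ∈ W) {t : ℝ} (h0 : 0 ≤ t) (ht : t < ε) :
    ‖Φ x t - x‖ ≤ Mf * t := by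
  have h1 := (convex_Ioo (-ε) ε).norm_image_sub_le_of_norm_hasDerivWithin_le
    (f := Φ x) (f' := fun τ => f (Φ x τ)) (C := Mf) (x := 0) (y := t)
    (fun τ hτ => (hΦ.ode x hx τ hτ).hasDerivWithinAt)
    (fun τ hτ => hMf _ (hΦ.bdd x hx τ hτ)) ⟨by linarith, by linarith⟩ ⟨by linarith, ht⟩
  rw [hΦ.atzero x hx] at h1
  simpa [abs_of_nonneg h0] using h1

theorem YY_eq {n : ℕ} {B : Fin n → (Fin n → ℝ) → ℝ} {C : (Fin n → ℝ) → ℝ}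
    {O : Set (ℝ × (Fin n → ℝ) × (Fin n → ℝ))} (F : SmoothFamily B C O) {t : ℝ}
    {r : (Fin n → ℝ) × (Fin n → ℝ)} (hr : (t, r) ∈ O)
    {y : ℝ → (Fin n → ℝ) × (Fin n → ℝ)}
    (hy : ∀ τ ∈ Icc (0:ℝ) t, HasDerivAt y (vf B C (y τ)) τ)
    (he : ∀ τ ∈ Icc (0:ℝ) t, F.f τ t r.1 r.2 = (y τ).1) :
    ∀ τ ∈ Icc (0:ℝ) t, YY F t r τ = y τ := by
  intro τ hτ
  have ht : 0 < t := F.pos _ hr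
  refine Prod.ext (he τ hτ) ?_
  have h1 : HasDerivAt (fun s => (YY F t r s).1) (YY F t r τ).2 τ := (YY_ode F hr τ hτ).fst
  have h2 : HasDerivAt (fun s => (y s).1) (y τ).2 τ := (hy τ hτ).fst
  have hu : UniqueDiffWithinAt ℝ (Icc 0 t) τ := uniqueDiffOn_Icc ht τ hτ
  exact hu.eq_deriv _ h1.hasDerivWithinAt
    (h2.hasDerivWithinAt.congr (fun s hs => he s hs) (he τ hτ))

end MechPart

/-- short-time asymptotics, uniformly over a compact set `K`, of the
solutions with initial velocity `-B`: endpoint expansion, action bound, and the inverse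
mixed Hessian of the Hamilton function. -/
theorem statement19 {n : ℕ} (hn : 1 ≤ n)
    (B : Fin n → (Fin n → ℝ) → ℝ) (C : (Fin n → ℝ) → ℝ)
    (hB : ∀ i, ContDiff ℝ (⊤ : ℕ∞) (B i)) (hC : ContDiff ℝ (⊤ : ℕ∞) C)
    (K : Set (Fin n → ℝ)) (hK : IsCompact K) :
    ∃ t0 : ℝ, 0 < t0 ∧ ∃ c : ℝ, 0 < c ∧
      ∃ U : Set (Fin n → ℝ), IsOpen U ∧ K ⊆ U ∧
        ∃ γ : (Fin n → ℝ) → ℝ → Fin n → ℝ,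
          ContDiffOn ℝ (⊤ : ℕ∞) (fun p : (Fin n → ℝ) × ℝ => γ p.1 p.2)
            (U ×ˢ Ioo (-t0) (2 * t0)) ∧
          (∀ q ∈ U, IsClassical B C t0 (γ q) ∧ γ q 0 = q ∧
            deriv (γ q) 0 = (fun i => -(B i q))) ∧
          ∀ q ∈ K, ∀ t : ℝ, 0 < t → t ≤ t0 →
            (∀ i, |γ q t i - (q i - t * B i q)| ≤ c * t ^ 2) ∧
            |action B C t (γ q)| ≤ c * t ∧
            (∀ (O : Set (ℝ × (Fin n → ℝ) × (Fin n → ℝ))) (F : SmoothFamily B C O),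
              (t, q, γ q t) ∈ O →
              (∀ τ ∈ Icc (0:ℝ) t, F.f τ t q (γ q t) = γ q τ) →
              ∀ k l : Fin n,
                |(Hess01 (fun a b c' => -(famS F a b c')) t q (γ q t))⁻¹ k l
                    - t * (if k = l then 1 else 0)| ≤ c * t ^ 2) := by
  classical
  have hf := vf_smooth hB hC
  have hBc : Continuous (fun q : Fin n → ℝ => fun i => -(B i q)) :=
    continuous_pi fun i => (hB i).continuous.neg
  have hBs : ContDiff ℝ (⊤ : ℕ∞) (fun q : Fin n → ℝ => fun i => -(B i q)) :=
    contDiff_pi.2 fun i => (hB i).neg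
  set z : (Fin n → ℝ) → (Fin n → ℝ) × (Fin n → ℝ) := fun q => (q, fun i => -(B i q)) with hz
  have hzc : Continuous z := continuous_id.prodMk hBc
  have hzs : ContDiff ℝ (⊤ : ℕ∞) z := contDiff_id.prodMk hBs
  have hK0 : IsCompact (z '' K) := hK.image hzc
  have hK1 : IsCompact (Metric.cthickening 1 (z '' K)) := hK0.cthickening
  obtain ⟨ε, hε, W, hW, hKW, M, Φ, hΦ⟩ := flow_compact hf hK1
  obtain ⟨Mf, hMf0, hMf⟩ := bdd_ball hf.continuous M
  obtain ⟨ML, hML0, hML⟩ := bdd_ball (Lag_smooth hB hC).continuous M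
  obtain ⟨c3, hc30, hc3⟩ := hess_bound hB hC hW hΦ
  set t0 : ℝ := min (ε / 2) (1 / Mf) with ht0
  have ht0p : 0 < t0 := lt_min (by linarith) (by positivity)
  have ht01 : t0 ≤ ε / 2 := min_le_left _ _
  have ht02 : Mf * t0 ≤ 1 := by
    have : t0 ≤ 1 / Mf := min_le_right _ _
    rwa [le_div_iff₀ hMf0, mul_comm] at this
  have hd1 : ∀ q, z q ∈ W → ∀ τ ∈ Ioo (-ε) ε,
      HasDerivAt (fun s => (Φ (z q) s).1) (Φ (z q) τ).2 τ := fun q hq τ hτ =>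
    (hΦ.ode _ hq τ hτ).fst
  have hd2 : ∀ q, z q ∈ W → ∀ τ ∈ Ioo (-ε) ε,
      HasDerivAt (fun s => (Φ (z q) s).2) (vf B C (Φ (z q) τ)).2 τ := fun q hq τ hτ =>
    (hΦ.ode _ hq τ hτ).snd
  have hKz : ∀ q ∈ K, ∀ t, 0 ≤ t → t ≤ t0 → Φ (z q) t ∈ W := by
    intro q hq t h0 h1
    have hzW : z q ∈ W := hKW (Metric.self_subset_cthickening _ (mem_image_of_mem z hq))
    refine hKW (Metric.mem_cthickening_of_dist_le _ (z q) _ _ (mem_image_of_mem z hq) ?_)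
    rw [dist_eq_norm]
    refine (hΦ.near_start hMf hzW h0 (by linarith)).trans (le_trans ?_ ht02)
    gcongr
  refine ⟨t0, ht0p, Mf + ML + c3, by positivity, {q | z q ∈ W}, hW.preimage hzc,
    fun q hq => hKW (Metric.self_subset_cthickening _ (mem_image_of_mem z hq)),
    fun q τ => (Φ (z q) τ).1, ?_, ?_, ?_⟩
  · have h1 : ContDiff ℝ (⊤ : ℕ∞) (fun p : (Fin n → ℝ) × ℝ => (z p.1, p.2)) :=
      (hzs.comp contDiff_fst).prodMk contDiff_snd
    refine contDiff_fst.comp_contDiffOn (hΦ.smooth.comp h1.contDiffOn ?_)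
    rintro ⟨q, τ⟩ ⟨hq, hτ⟩
    exact ⟨hq, by linarith [hτ.1], by linarith [hτ.2]⟩
  · intro q hq
    have hmem : ∀ τ ∈ Icc (0:ℝ) t0, τ ∈ Ioo (-ε) ε := fun τ hτ =>
      ⟨by linarith [hτ.1], by linarith [hτ.2]⟩
    refine ⟨fun τ hτ i => ?_, ?_, ?_⟩
    · have e1 : deriv (fun s => (Φ (z q) s).1) =ᶠ[nhds τ] fun s => (Φ (z q) s).2 := by
        filter_upwards [isOpen_Ioo.mem_nhds (hmem τ hτ)] with s hs
        exact (hd1 q hq s hs).deriv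
      rw [e1.deriv_eq, (hd2 q hq τ (hmem τ hτ)).deriv, e1.self_of_nhds]
      simp only [vf]
      ring
    · change (Φ (z q) 0).1 = q
      rw [hΦ.atzero _ hq]
    · rw [(hd1 q hq 0 ⟨by linarith, by linarith⟩).deriv, hΦ.atzero _ hq]
  · intro q hq t htp htt
    have hzW : z q ∈ W := hKW (Metric.self_subset_cthickening _ (mem_image_of_mem z hq))
    have hmem : ∀ τ ∈ Icc (0:ℝ) t, τ ∈ Ioo (-ε) ε := fun τ hτ =>
      ⟨by linarith [hτ.1], by linarith [hτ.2]⟩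
    refine ⟨fun i => ?_, ?_, ?_⟩
    · have h1 := taylor2 (δ := ε) (t := t) (M := Mf)
        (g := fun s => (Φ (z q) s).1 - q - s • (z q).2)
        (g' := fun s => (Φ (z q) s).2 - (z q).2)
        (g'' := fun s => (vf B C (Φ (z q) s)).2)
        (by simp only [hΦ.atzero _ hzW]; simp [hz]) (by simp [hΦ.atzero _ hzW])
        (fun s hs => by
          have a3 : HasDerivAt (fun s : ℝ => s • (z q).2) (z q).2 s := by
            simpa using (hasDerivAt_id s).smul_const (z q).2
          exact ((hd1 q hzW s hs).sub_const q).sub a3)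
        (fun s hs => (hd2 q hzW s hs).sub_const _)
        (fun s hs => (norm_snd_le _).trans (hMf _ (hΦ.bdd _ hzW s hs)))
        (hmem t ⟨htp.le, le_rfl⟩)
      have h2 := (norm_le_pi_norm _ i).trans h1
      have h3 : (Φ (z q) t).1 i - (q i - t * B i q)
          = ((Φ (z q) t).1 - q - t • (z q).2) i := by
        simp [hz]; ring
      change |(Φ (z q) t).1 i - (q i - t * B i q)| ≤ _
      rw [h3, ← Real.norm_eq_abs]
      refine h2.trans ?_
      gcongr
      linarith
    · have h1 : action B C t (fun τ => (Φ (z q) τ).1) = ∫ τ in (0:ℝ)..t, Lag B C (Φ (z q) τ) := by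
        unfold action
        refine intervalIntegral.integral_congr fun τ hτ => ?_
        rw [uIcc_of_le htp.le] at hτ
        simp only [(hd1 q hzW τ (hmem τ hτ)).deriv, Lag]
      change |action B C t (fun τ => (Φ (z q) τ).1)| ≤ _
      rw [h1, ← Real.norm_eq_abs]
      have h2 := intervalIntegral.norm_integral_le_of_norm_le_const (a := 0) (b := t) (C := ML)
        (f := fun τ => Lag B C (Φ (z q) τ)) (fun τ hτ => by
          rw [uIoc_of_le htp.le] at hτ
          exact hML _ (hΦ.bdd _ hzW _ (hmem τ (Ioc_subset_Icc_self hτ))))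
      rw [sub_zero, abs_of_pos htp] at h2
      refine h2.trans ?_
      gcongr
      linarith
    · intro O F hO hF k l
      have hY := YY_eq F (r := (q, (Φ (z q) t).1)) hO (y := Φ (z q))
        (fun τ hτ => hΦ.ode _ hzW τ (hmem τ hτ)) hF
      refine (hc3 t (by linarith) q (Φ (z q) t).1 O F hO ?_ ?_ k l).trans ?_
      · rw [hY _ ⟨by linarith, by linarith⟩]
        exact hKz q hq _ (by linarith) (by linarith)
      · rw [hY _ ⟨by linarith, by linarith⟩]
        exact hKz q hq _ (by linarith) (by linarith)
      · gcongr
        linarith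
end
end
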